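/- arXiv:0904.1682 — 8 statements merged into one kernel-verified Lean document; each statement's English description precedes it below -/
import Mathlib

section
/- Consider the implicit (backward) Euler discretization of the differential inclusion ẋ(t) ∈ -sgn(x(t)): sequences (x_k)_{k≥0} and (s_k)_{k≥1} in ℝ satisfying x_{k+1} - x_k = -h·s_{k+1} and s_{k+1} ∈ sgn(x_{k+1}) for all k ≥ 0, with x_0 = x₀. Then for every step size h > 0 and every initial value x₀ ∈ ℝ, there exists k₀ ∈ ℕ such that x_{k₀+n} = 0 for all integers n ≥ 1 (and consequently (x_{k₀+n+1} - x_{k₀+n})/h = 0 for all n ≥ 1). -/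
open Set

noncomputable section

/-- The set-valued sign function: `sgn(x) = {1}` if `x > 0`, `{-1}` if `x < 0`,
and `[-1,1]` if `x = 0`. -/
def sgnSet (x : ℝ) : Set ℝ := if 0 < x then {1} else if x < 0 then {-1} else Icc (-1) 1

/-- Implicit (backward) Euler discretization of `ẋ ∈ -sgn(x)`: for every step size `h > 0`
and every initial value, the iterates reach `0` in finite time and stay there, and the
discrete derivative vanishes there as well. -/
theorem backwardEuler_sgn_finite_time_stabilization
    (h : ℝ) (hh : 0 < h) (x₀ : ℝ) (x s : ℕ → ℝ) (hx0 : x 0 = x₀)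
    (hdyn : ∀ k : ℕ, x (k + 1) - x k = -h * s (k + 1))
    (hsgn : ∀ k : ℕ, s (k + 1) ∈ sgnSet (x (k + 1))) :
    ∃ k₀ : ℕ, (∀ n : ℕ, 1 ≤ n → x (k₀ + n) = 0) ∧
      (∀ n : ℕ, 1 ≤ n → (x (k₀ + n + 1) - x (k₀ + n)) / h = 0) := by
  have key : ∀ k, x (k+1) = 0 ∨ |x (k+1)| = |x k| - h := by
    intro k
    have h1 := hdyn k
    have h2 := hsgn k
    unfold sgnSet at h2
    rcases lt_trichotomy (x (k+1)) 0 with hx | hx | hx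
    · right
      rw [if_neg (not_lt.mpr hx.le), if_pos hx, mem_singleton_iff] at h2
      rw [h2] at h1
      rw [abs_of_neg hx, abs_of_neg (by linarith)]
      linarith
    · exact Or.inl hx
    · right
      rw [if_pos hx, mem_singleton_iff] at h2
      rw [h2] at h1
      rw [abs_of_pos hx, abs_of_pos (by linarith)]
      linarith
  have hstay : ∀ k, x k = 0 → x (k+1) = 0 := by
    intro k hk
    rcases key k with h1 | h1
    · exact h1
    · rw [hk, abs_zero] at h1
      have := abs_nonneg (x (k+1))
      linarith
  have hex : ∃ k, x k = 0 := by
    by_contra hne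
    push Not at hne
    have hb : ∀ k : ℕ, |x k| = |x 0| - k * h := by
      intro k
      induction k with
      | zero => simp
      | succ k ih =>
        rcases key k with h1 | h1
        · exact absurd h1 (hne _)
        · rw [h1, ih]
          push_cast
          ring
    obtain ⟨n, hn⟩ := exists_nat_gt (|x 0| / h)
    rw [div_lt_iff₀ hh] at hn
    have h1 := hb n
    have h2 := abs_nonneg (x n)
    linarith
  obtain ⟨k, hk⟩ := hex
  have hall : ∀ n, x (k + n) = 0 := by
    intro n
    induction n with
    | zero => exact hk
    | succ n ih => exact hstay _ ih
  refine ⟨k, fun n _ => hall n, fun n _ => ?_⟩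
  have h1 := hall (n+1)
  rw [← add_assoc] at h1
  rw [h1, hall n]
  simp
end
end

section
/- Let A : ℝⁿ ⇉ ℝⁿ be a maximal monotone operator with domain D(A), and let f : [0,T] × ℝⁿ → ℝⁿ satisfy Assumptions (ii) and (iii). Then for every x₀ ∈ D(A), the differential inclusion ẋ(t) ∈ -A(x(t)) + f(t, x(t)) a.e. on (0,T) with x(0) = x₀ has a unique Lipschitz solution x : [0,T] → ℝⁿ. -/
open MeasureTheory Set
open scoped RealInnerProductSpace

noncomputable section

/-- A Lipschitz solution on `[0,T]` of the differential inclusion `ẋ(t) ∈ F(t, x(t))`,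
`x(0) = x₀`: a Lipschitz continuous function with the prescribed initial value,
differentiable at a.e. `t ∈ (0,T)` with derivative in `F(t, x(t))`. -/
def IsLipschitzSolution {E : Type*} [NormedAddCommGroup E] [NormedSpace ℝ E]
    (F : ℝ → E → Set E) (T : ℝ) (x₀ : E) (x : ℝ → E) : Prop :=
  (∃ K : NNReal, LipschitzOnWith K x (Icc 0 T)) ∧ x 0 = x₀ ∧
    ∀ᵐ t ∂volume, t ∈ Ioo 0 T → ∃ v ∈ F t (x t), HasDerivAt x v t

/-- Assumption (ii): `f` is Lipschitz in its second argument, uniformly in `t ∈ [0,T]`. -/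
def AssumptionII {E : Type*} [NormedAddCommGroup E] (T : ℝ) (f : ℝ → E → E) : Prop :=
  ∃ L : ℝ, 0 ≤ L ∧ ∀ t ∈ Icc (0 : ℝ) T, ∀ x₁ x₂ : E, ‖f t x₁ - f t x₂‖ ≤ L * ‖x₁ - x₂‖

/-- Assumption (iii): `f(·,x)` is differentiable in `t`, and for every `R ≥ 0` the supremum
`Φ(R)` of the `L²((0,T))` norms of `t ↦ ∂f/∂t(t, v(t))` over `v` with `‖v‖_{L²} ≤ R`
is finite. -/
def AssumptionIII {E : Type*} [NormedAddCommGroup E] [NormedSpace ℝ E]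
    (T : ℝ) (f : ℝ → E → E) : Prop :=
  (∀ x : E, Differentiable ℝ fun t => f t x) ∧
  ∀ R : ℝ, 0 ≤ R → ∃ M : ℝ,
    ∀ v : ℝ → E, eLpNorm v 2 (volume.restrict (Ioo 0 T)) ≤ ENNReal.ofReal R →
      eLpNorm (fun t => deriv (fun τ => f τ (v t)) t) 2 (volume.restrict (Ioo 0 T)) ≤
        ENNReal.ofReal M

/-- The set-valued operator `A : ℝⁿ ⇉ ℝⁿ` is maximal monotone. -/
def MaximalMonotone {n : ℕ}
    (A : EuclideanSpace ℝ (Fin n) → Set (EuclideanSpace ℝ (Fin n))) : Prop :=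
  (∀ x y x' y' : EuclideanSpace ℝ (Fin n), x' ∈ A x → y' ∈ A y → 0 ≤ ⟪x' - y', x - y⟫) ∧
  (∀ x x' : EuclideanSpace ℝ (Fin n),
    (∀ y y' : EuclideanSpace ℝ (Fin n), y' ∈ A y → 0 ≤ ⟪x' - y', x - y⟫) → x' ∈ A x)


lemma mm_finite {E : Type*} [NormedAddCommGroup E] [InnerProductSpace ℝ E]
    {ι : Type*} [Fintype ι] [Nonempty ι] (a b : ι → E)
    (hm : ∀ i j, 0 ≤ ⟪b i - b j, a i - a j⟫) :
    ∃ x : E, ∀ i, ⟪b i + x, x - a i⟫ ≤ 0 := by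
  classical
  let W : (ι → ℝ) → E := fun l => ∑ i, l i • (a i - b i)
  let S : (ι → ℝ) → ℝ := fun l => ∑ i, l i * ⟪a i, b i⟫
  have hcont : Continuous fun l : ι → ℝ => -‖W l‖ ^ 2 / 4 - S l := by
    simp only [W, S]; fun_prop
  obtain ⟨l, hl, hmax⟩ := (isCompact_stdSimplex ℝ ι).exists_isMaxOn
    ⟨_, single_mem_stdSimplex ℝ (Classical.arbitrary ι)⟩ hcont.continuousOn
  have hS : -‖W l‖ ^ 2 / 4 ≤ S l := by
    have h1 : 0 ≤ ∑ i, ∑ j, l i * l j * ⟪b i - b j, a i - a j⟫ :=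
      Finset.sum_nonneg fun i _ => Finset.sum_nonneg fun j _ =>
        mul_nonneg (mul_nonneg (hl.1 i) (hl.1 j)) (hm i j)
    set X := ∑ i, l i • a i with hX
    set Y := ∑ i, l i • b i with hY
    have hXY : ⟪Y, X⟫ = ∑ i, ∑ j, l i * l j * ⟪b i, a j⟫ := by
      rw [hX, hY, sum_inner]
      refine Finset.sum_congr rfl fun i _ => ?_
      rw [inner_sum]
      refine Finset.sum_congr rfl fun j _ => ?_
      rw [inner_smul_left, inner_smul_right]
      simp only [conj_trivial]; ring
    have hXY' : ⟪Y, X⟫ = ∑ i, ∑ j, l i * l j * ⟪b j, a i⟫ := by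
      rw [hXY, Finset.sum_comm]
      refine Finset.sum_congr rfl fun i _ => Finset.sum_congr rfl fun j _ => ?_
      ring
    have hS1 : S l = ∑ i, ∑ j, l i * l j * ⟪b i, a i⟫ := by
      simp only [S]
      refine Finset.sum_congr rfl fun i _ => ?_
      rw [← Finset.sum_mul, ← Finset.mul_sum, hl.2, real_inner_comm]; ring
    have hS2 : S l = ∑ i, ∑ j, l i * l j * ⟪b j, a j⟫ := by
      rw [hS1, Finset.sum_comm]
      refine Finset.sum_congr rfl fun i _ => Finset.sum_congr rfl fun j _ => ?_
      ring
    have h2 : ∑ i, ∑ j, l i * l j * ⟪b i - b j, a i - a j⟫ = 2 * S l - 2 * ⟪Y, X⟫ := by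
      have : 2 * S l - 2 * ⟪Y, X⟫ = S l + S l - ⟪Y, X⟫ - ⟪Y, X⟫ := by ring
      rw [this]
      nth_rewrite 1 [hS1]
      nth_rewrite 1 [hS2]
      nth_rewrite 1 [hXY]
      rw [hXY']
      simp only [← Finset.sum_add_distrib, ← Finset.sum_sub_distrib]
      refine Finset.sum_congr rfl fun i _ => Finset.sum_congr rfl fun j _ => ?_
      simp only [inner_sub_left, inner_sub_right]; ring
    have h3 : W l = X - Y := by
      simp only [W, hX, hY, smul_sub, Finset.sum_sub_distrib]
    have h4 := norm_sub_sq_real X Y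
    have h5 := norm_add_sq_real X Y
    rw [h3]
    rw [real_inner_comm] at h2
    nlinarith [sq_nonneg ‖X + Y‖]
  refine ⟨(1/2 : ℝ) • W l, fun i => ?_⟩
  set p := (a i - b i) - W l with hp
  have key : ∀ s ∈ Ioc (0:ℝ) 1, -⟪W l, p⟫ / 2 - (⟪a i, b i⟫ - S l) ≤ s * (‖p‖ ^ 2 / 4) := by
    intro s hs
    have hmem : (1 - s) • l + s • (Pi.single i 1 : ι → ℝ) ∈ stdSimplex ℝ ι :=
      convex_stdSimplex ℝ ι hl (single_mem_stdSimplex ℝ i) (by linarith [hs.2]) hs.1.le (by ring)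
    have h := hmax hmem
    have hW : W ((1 - s) • l + s • (Pi.single i 1 : ι → ℝ)) = W l + s • p := by
      simp only [W, Pi.add_apply, Pi.smul_apply, add_smul, Finset.sum_add_distrib, smul_eq_mul,
        mul_smul, ← Finset.smul_sum, hp]
      simp [Pi.single_apply, ite_smul]
      module
    have hSs : S ((1 - s) • l + s • (Pi.single i 1 : ι → ℝ)) = S l + s * (⟪a i, b i⟫ - S l) := by
      simp only [S, Pi.add_apply, Pi.smul_apply, add_mul, Finset.sum_add_distrib, smul_eq_mul,
        mul_assoc, ← Finset.mul_sum]
      simp [Pi.single_apply]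
      ring
    simp only [mem_ofPred_eq, hW, hSs] at h
    rw [norm_add_sq_real, inner_smul_right, norm_smul, mul_pow] at h
    simp only [Real.norm_eq_abs, sq_abs] at h
    have : s * (-⟪W l, p⟫ / 2 - (⟪a i, b i⟫ - S l)) ≤ s * (s * (‖p‖ ^ 2 / 4)) := by nlinarith
    exact le_of_mul_le_mul_left this hs.1
  have key2 : -⟪W l, p⟫ / 2 - (⟪a i, b i⟫ - S l) ≤ 0 := by
    by_contra hcon
    push Not at hcon
    set c := -⟪W l, p⟫ / 2 - (⟪a i, b i⟫ - S l)
    have hq : 0 ≤ ‖p‖ ^ 2 / 4 := by positivity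
    set q := ‖p‖ ^ 2 / 4
    have h1 := key (min 1 (c / (2 * (q + 1)))) ⟨by positivity, min_le_left _ _⟩
    have h2 : min 1 (c / (2 * (q + 1))) * q ≤ c / (2 * (q + 1)) * q :=
      mul_le_mul_of_nonneg_right (min_le_right _ _) hq
    have h3 : c / (2 * (q + 1)) * q < c := by
      rw [div_mul_eq_mul_div, div_lt_iff₀ (by positivity)]
      nlinarith
    linarith
  have hf : ⟪b i + (1/2 : ℝ) • W l, (1/2 : ℝ) • W l - a i⟫
      = - ⟪W l, p⟫ / 2 - ‖W l‖ ^ 2 / 4 - ⟪a i, b i⟫ := by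
    simp only [hp, inner_add_left, inner_sub_right, inner_smul_left, inner_smul_right,
      real_inner_self_eq_norm_sq, conj_trivial]
    rw [real_inner_comm (W l) (b i), real_inner_comm (a i) (b i)]
    ring
  rw [hf]
  linarith

lemma mm_resolvent {n : ℕ} {A : EuclideanSpace ℝ (Fin n) → Set (EuclideanSpace ℝ (Fin n))}
    (hA : MaximalMonotone A) {x₀ : EuclideanSpace ℝ (Fin n)} (hx₀ : (A x₀).Nonempty)
    {h : ℝ} (hh : 0 < h) (z : EuclideanSpace ℝ (Fin n)) :
    ∃ x, h⁻¹ • (z - x) ∈ A x := by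
  classical
  obtain ⟨a₀, ha₀⟩ := hx₀
  let G := {p : EuclideanSpace ℝ (Fin n) × EuclideanSpace ℝ (Fin n) // p.2 ∈ A p.1}
  let C : G → Set (EuclideanSpace ℝ (Fin n)) := fun p =>
    {x | ⟪(h • p.1.2 - z) + x, x - p.1.1⟫ ≤ 0}
  have hclosed : ∀ p, IsClosed (C p) := fun p =>
    isClosed_le (by fun_prop) continuous_const
  let g₀ : G := ⟨(x₀, a₀), ha₀⟩
  have hcomp : IsCompact (C g₀) := by
    refine Metric.isCompact_of_isClosed_isBounded (hclosed _) ?_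
    refine (Metric.isBounded_closedBall (x := x₀) (r := ‖h • a₀ - z + x₀‖)).subset ?_
    intro x hx
    simp only [C, g₀, mem_ofPred_eq] at hx
    rw [mem_closedBall_iff_norm]
    have e : h • a₀ - z + x = (h • a₀ - z + x₀) + (x - x₀) := by abel
    rw [e, inner_add_left, real_inner_self_eq_norm_sq] at hx
    have h1 := neg_le_of_abs_le (abs_real_inner_le_norm (h • a₀ - z + x₀) (x - x₀))
    by_contra hcon
    push Not at hcon
    have : 0 < ‖x - x₀‖ := lt_of_le_of_lt (norm_nonneg _) hcon
    nlinarith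
  obtain ⟨x, hx⟩ := hcomp.inter_iInter_nonempty C hclosed (fun u => by
    have : Nonempty {p // p ∈ insert g₀ u} := ⟨⟨g₀, by simp⟩⟩
    obtain ⟨x, hx⟩ := mm_finite (ι := {p // p ∈ insert g₀ u}) (fun p => p.1.1.1)
      (fun p => h • p.1.1.2 - z) (by
        intro i j
        have := hA.1 _ _ _ _ i.1.2 j.1.2
        have e : h • i.1.1.2 - z - (h • j.1.1.2 - z) = h • (i.1.1.2 - j.1.1.2) := by module
        rw [e, inner_smul_left]
        exact mul_nonneg hh.le this)
    refine ⟨x, hx ⟨g₀, by simp⟩, ?_⟩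
    simp only [mem_iInter]
    intro p hp
    exact hx ⟨p, by simp [hp]⟩)
  refine ⟨x, hA.2 _ _ fun y y' hy => ?_⟩
  have h1 := mem_iInter.1 hx.2 ⟨(y, y'), hy⟩
  simp only [C, mem_ofPred_eq] at h1
  have e : h⁻¹ • (z - x) - y' = (-h⁻¹) • (h • y' - z + x) := by
    have : h⁻¹ • h • y' = y' := by rw [smul_smul, inv_mul_cancel₀ hh.ne', one_smul]
    rw [neg_smul, smul_add, smul_sub, smul_sub, this]; abel
  rw [e, inner_smul_left]
  simp only [conj_trivial]
  have : 0 < h⁻¹ := by positivity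
  nlinarith

lemma mm_nonexp {n : ℕ} {A : EuclideanSpace ℝ (Fin n) → Set (EuclideanSpace ℝ (Fin n))}
    (hA : MaximalMonotone A) {h : ℝ} (hh : 0 < h) {z w x y : EuclideanSpace ℝ (Fin n)}
    (hx : h⁻¹ • (z - x) ∈ A x) (hy : h⁻¹ • (w - y) ∈ A y) : ‖x - y‖ ≤ ‖z - w‖ := by
  have h1 := hA.1 _ _ _ _ hx hy
  have e : h⁻¹ • (z - x) - h⁻¹ • (w - y) = h⁻¹ • ((z - w) - (x - y)) := by module
  rw [e, inner_smul_left, inner_sub_left, real_inner_self_eq_norm_sq] at h1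
  have h2 : 0 < h⁻¹ := by positivity
  have h3 : 0 ≤ ⟪z - w, x - y⟫ - ‖x - y‖ ^ 2 := by
    by_contra hc
    push Not at hc
    have := mul_neg_of_pos_of_neg h2 hc
    simp at h1
    linarith
  have h4 := real_inner_le_norm (z - w) (x - y)
  by_contra hcon
  push Not at hcon
  nlinarith [norm_nonneg (z - w), norm_nonneg (x - y)]

lemma mm_incr {E : Type*} [NormedAddCommGroup E] [NormedSpace ℝ E] [CompleteSpace E]
    {g : ℝ → E} (hg : Differentiable ℝ g) {a b T : ℝ} (ha : 0 ≤ a) (hab : a ≤ b) (hb : b ≤ T)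
    (hfin : ∫⁻ t in Ioo 0 T, ‖deriv g t‖ₑ ≠ ⊤) :
    ENNReal.ofReal ‖g b - g a‖ ≤ ∫⁻ t in Ioo a b, ‖deriv g t‖ₑ := by
  have hsub : Ioo a b ⊆ Ioo 0 T := fun t ht => ⟨ha.trans_lt ht.1, ht.2.trans_le hb⟩
  have hle : ∫⁻ t in Ioo a b, ‖deriv g t‖ₑ ≤ ∫⁻ t in Ioo 0 T, ‖deriv g t‖ₑ :=
    lintegral_mono_set hsub
  have hint : IntegrableOn (deriv g) (Ioo a b) := by
    refine ⟨(aestronglyMeasurable_deriv g _), ?_⟩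
    exact lt_of_le_of_lt hle (lt_top_iff_ne_top.2 hfin)
  have hii : IntervalIntegrable (deriv g) volume a b := by
    rw [intervalIntegrable_iff_integrableOn_Ioo_of_le hab]; exact hint
  rw [← intervalIntegral.integral_eq_sub_of_hasDerivAt
    (fun t _ => (hg t).hasDerivAt) hii, intervalIntegral.integral_of_le hab,
    integral_Ioc_eq_integral_Ioo, ofReal_norm]
  exact enorm_integral_le_lintegral_enorm _

lemma mm_var {n : ℕ} {T : ℝ} (hT : 0 < T)
    {f : ℝ → EuclideanSpace ℝ (Fin n) → EuclideanSpace ℝ (Fin n)}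
    (hf : AssumptionIII T f) (R : ℝ) :
    ∃ M : ℝ, 0 ≤ M ∧ ∀ N : ℕ, 0 < N → ∀ u : ℕ → EuclideanSpace ℝ (Fin n),
      (∀ k < N, ‖u k‖ ≤ R) →
      ∑ k ∈ Finset.range N, ‖f ((k + 1 : ℕ) * (T / N)) (u k) - f (k * (T / N)) (u k)‖ ≤ M := by
  set c : ENNReal := (volume.restrict (Ioo 0 T)) univ ^ (2 : ENNReal).toReal⁻¹ * ENNReal.ofReal R
    with hc
  have hcfin : c ≠ ⊤ := by
    rw [hc]
    refine ENNReal.mul_ne_top (ENNReal.rpow_ne_top_of_nonneg (by positivity) ?_)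
      ENNReal.ofReal_ne_top
    simp
  obtain ⟨M, hM⟩ := hf.2 c.toReal ENNReal.toReal_nonneg
  rw [ENNReal.ofReal_toReal hcfin] at hM
  set B : ENNReal := ENNReal.ofReal T + ENNReal.ofReal M ^ 2 with hB
  have hBfin : B ≠ ⊤ := by simp [hB]
  have L1 : ∀ v : ℝ → EuclideanSpace ℝ (Fin n), (∀ t ∈ Ioo 0 T, ‖v t‖ ≤ R) →
      ∫⁻ t in Ioo 0 T, ‖deriv (fun τ => f τ (v t)) t‖ₑ ≤ B := by
    intro v hv
    have h1 := hM v (eLpNorm_le_of_ae_bound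
      ((ae_restrict_iff' measurableSet_Ioo).2 (Filter.Eventually.of_forall hv)))
    have h2 : ∫⁻ t in Ioo 0 T, ‖deriv (fun τ => f τ (v t)) t‖ₑ ^ 2 ≤ ENNReal.ofReal M ^ 2 := by
      have h3 := eLpNorm_nnreal_pow_eq_lintegral (p := 2) (μ := volume.restrict (Ioo 0 T))
        (f := fun t => deriv (fun τ => f τ (v t)) t) (by norm_num)
      have h4 := pow_le_pow_left' h1 2
      norm_num at h3
      rw [← h3]
      exact h4
    calc ∫⁻ t in Ioo 0 T, ‖deriv (fun τ => f τ (v t)) t‖ₑ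
        ≤ ∫⁻ t in Ioo 0 T, (1 + ‖deriv (fun τ => f τ (v t)) t‖ₑ ^ 2) := by
          refine lintegral_mono fun t => ?_
          generalize ‖deriv (fun τ => f τ (v t)) t‖ₑ = x
          rcases le_total x 1 with h | h
          · exact h.trans le_self_add
          · calc x = x * 1 := by simp
              _ ≤ x * x := by gcongr
              _ = x ^ 2 := by ring
              _ ≤ _ := le_add_self
      _ = ENNReal.ofReal T + ∫⁻ t in Ioo 0 T, ‖deriv (fun τ => f τ (v t)) t‖ₑ ^ 2 := by
          rw [lintegral_add_left measurable_const]
          simp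
      _ ≤ B := by rw [hB]; gcongr
  refine ⟨B.toReal, ENNReal.toReal_nonneg, fun N hN u hu => ?_⟩
  have hN' : (0:ℝ) < N := by exact_mod_cast hN
  have hh : 0 < T / N := by positivity
  set h := T / N with hhdef
  have hNh : N * h = T := by rw [hhdef]; field_simp
  let I : ℕ → Set ℝ := fun k => Ioo (k * h) ((k + 1 : ℕ) * h)
  have hfloor : ∀ k : ℕ, ∀ t ∈ I k, ⌊t / h⌋₊ = k := by
    intro k t ht
    have ht0 : 0 ≤ t := le_trans (by positivity) ht.1.le
    rw [Nat.floor_eq_iff (by positivity), le_div_iff₀ hh, div_lt_iff₀ hh]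
    refine ⟨ht.1.le, ?_⟩
    have := ht.2
    push_cast at this
    exact this
  let v : ℝ → EuclideanSpace ℝ (Fin n) := fun t => u ⌊t / h⌋₊
  have hv : ∀ t ∈ Ioo 0 T, ‖v t‖ ≤ R := by
    intro t ht
    refine hu _ ?_
    rw [Nat.floor_lt (by have := ht.1; positivity), div_lt_iff₀ hh, hNh]
    exact ht.2
  have hIsub : ∀ k < N, I k ⊆ Ioo 0 T := by
    intro k hk t ht
    have h1 : ((k + 1 : ℕ) : ℝ) ≤ N := by exact_mod_cast hk
    refine ⟨lt_of_le_of_lt (by positivity) ht.1, ht.2.trans_le ?_⟩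
    rw [← hNh]; gcongr
  have hstep : ∀ k < N,
      ENNReal.ofReal ‖f ((k + 1 : ℕ) * h) (u k) - f (k * h) (u k)‖
        ≤ ∫⁻ t in I k, ‖deriv (fun τ => f τ (v t)) t‖ₑ := by
    intro k hk
    have h1 : ((k + 1 : ℕ) : ℝ) ≤ N := by exact_mod_cast hk
    have h2 := mm_incr (hf.1 (u k)) (a := k * h) (b := (k + 1 : ℕ) * h) (T := T) (by positivity)
      (by gcongr; simp) (by rw [← hNh]; gcongr)
      (ne_top_of_le_ne_top hBfin (L1 (fun _ => u k) (fun _ _ => hu k hk)))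
    refine h2.trans (le_of_eq ?_)
    refine setLIntegral_congr_fun measurableSet_Ioo fun t ht => ?_
    simp only [v, hfloor k t ht]
  have hdisj : Set.PairwiseDisjoint (↑(Finset.range N)) I := by
    intro i _ j _ hij
    refine Set.disjoint_left.2 fun t hti htj => hij ?_
    rw [← hfloor i t hti, hfloor j t htj]
  rw [← ENNReal.ofReal_le_iff_le_toReal hBfin, ENNReal.ofReal_sum_of_nonneg (fun _ _ => norm_nonneg _)]
  calc _ ≤ ∑ k ∈ Finset.range N, ∫⁻ t in I k, ‖deriv (fun τ => f τ (v t)) t‖ₑ :=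
        Finset.sum_le_sum fun k hk => hstep k (Finset.mem_range.1 hk)
    _ = ∫⁻ t in ⋃ k ∈ Finset.range N, I k, ‖deriv (fun τ => f τ (v t)) t‖ₑ :=
        (lintegral_biUnion_finset hdisj (fun _ _ => measurableSet_Ioo) _).symm
    _ ≤ ∫⁻ t in Ioo 0 T, ‖deriv (fun τ => f τ (v t)) t‖ₑ :=
        lintegral_mono_set (iUnion₂_subset fun k hk => hIsub k (Finset.mem_range.1 hk))
    _ ≤ B := L1 v hv

lemma mm_unique {n : ℕ} {T : ℝ}
    {A : EuclideanSpace ℝ (Fin n) → Set (EuclideanSpace ℝ (Fin n))} (hA : MaximalMonotone A)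
    {f : ℝ → EuclideanSpace ℝ (Fin n) → EuclideanSpace ℝ (Fin n)}
    (hfII : AssumptionII T f) {x₀ : EuclideanSpace ℝ (Fin n)}
    {x y : ℝ → EuclideanSpace ℝ (Fin n)}
    (hx : IsLipschitzSolution (fun t ξ => {v | ∃ a ∈ A ξ, v = f t ξ - a}) T x₀ x)
    (hy : IsLipschitzSolution (fun t ξ => {v | ∃ a ∈ A ξ, v = f t ξ - a}) T x₀ y) :
    ∀ t ∈ Icc (0 : ℝ) T, y t = x t := by
  intro t ht
  obtain ⟨L, hL, hf⟩ := hfII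
  obtain ⟨⟨K, hK⟩, hx0, hxd⟩ := hx
  obtain ⟨⟨K', hK'⟩, hy0, hyd⟩ := hy
  have hsub : uIcc 0 t ⊆ Icc 0 T := by
    rw [uIcc_of_le ht.1]; exact Icc_subset_Icc le_rfl ht.2
  have hlip : LipschitzOnWith (K + K') (fun τ => ‖x τ - y τ‖) (uIcc 0 t) := by
    refine LipschitzOnWith.of_dist_le_mul fun a ha b hb => ?_
    have h1 := hK.dist_le_mul a (hsub ha) b (hsub hb)
    have h2 := hK'.dist_le_mul a (hsub ha) b (hsub hb)
    rw [dist_eq_norm] at h1 h2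
    rw [Real.dist_eq]
    refine (abs_norm_sub_norm_le _ _).trans ?_
    have e : x a - y a - (x b - y b) = (x a - x b) - (y a - y b) := by abel
    rw [e]
    refine (norm_sub_le _ _).trans ?_
    push_cast
    linarith
  have hac1 := hlip.absolutelyContinuousOnInterval
  have hac2 : AbsolutelyContinuousOnInterval (fun τ => Real.exp (-(2 * L) * τ)) 0 t := by
    refine ContDiffOn.absolutelyContinuousOnInterval (ContDiff.contDiffOn ?_)
    fun_prop
  have hac := (hac1.mul hac1).mul hac2
  have hint := hac.integral_deriv_eq_sub
  have hneg : ∫ τ in (0:ℝ)..t, deriv ((fun τ => ‖x τ - y τ‖) * (fun τ => ‖x τ - y τ‖) *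
      fun τ => Real.exp (-(2 * L) * τ)) τ ≤ 0 := by
    rw [intervalIntegral.integral_of_le ht.1, integral_Ioc_eq_integral_Ioo]
    refine integral_nonpos_of_ae ?_
    rw [Filter.EventuallyLE, ae_restrict_iff' measurableSet_Ioo]
    filter_upwards [hxd, hyd] with τ h1 h2 hτ
    have hτ' : τ ∈ Ioo 0 T := ⟨hτ.1, hτ.2.trans_le ht.2⟩
    obtain ⟨v, ⟨a, ha, rfl⟩, hv⟩ := h1 hτ'
    obtain ⟨w, ⟨b, hb, rfl⟩, hw⟩ := h2 hτ'
    have hd := ((hv.sub hw).norm_sq).mul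
      (((hasDerivAt_id τ).const_mul (-(2 * L))).exp)
    have hfun : ((fun τ => ‖x τ - y τ‖) * (fun τ => ‖x τ - y τ‖) *
      fun τ => Real.exp (-(2 * L) * τ)) = (fun τ => ‖(x - y) τ‖ ^ 2) * fun τ =>
        Real.exp (-(2 * L) * id τ) := by
      funext τ; simp [sq]
    rw [hfun, hd.deriv]
    have hm := hA.1 _ _ _ _ ha hb
    have hl := hf τ ⟨hτ'.1.le, hτ'.2.le⟩ (x τ) (y τ)
    have hcs := real_inner_le_norm (x τ - y τ) (f τ (x τ) - f τ (y τ))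
    have e : ⟪x τ - y τ, f τ (x τ) - a - (f τ (y τ) - b)⟫
        = ⟪x τ - y τ, f τ (x τ) - f τ (y τ)⟫ - ⟪a - b, x τ - y τ⟫ := by
      rw [real_inner_comm (x τ - y τ) (a - b), ← inner_sub_right]; congr 1; abel
    have hmain : ⟪x τ - y τ, f τ (x τ) - a - (f τ (y τ) - b)⟫ ≤ L * ‖x τ - y τ‖ ^ 2 := by
      rw [e]
      have := mul_le_mul_of_nonneg_left hl (norm_nonneg (x τ - y τ))
      nlinarith
    have hE := Real.exp_pos (-(2 * L) * τ)
    simp only [id, Pi.sub_apply, Pi.zero_apply]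
    nlinarith
  rw [hint] at hneg
  simp only [Pi.mul_apply, hx0, hy0, sub_self, norm_zero] at hneg
  have hE := Real.exp_pos (-(2 * L) * t)
  have h0 : ‖x t - y t‖ * ‖x t - y t‖ ≤ 0 := by
    by_contra hc
    push Not at hc
    have := mul_pos hc hE
    linarith
  have h1 : ‖x t - y t‖ = 0 := by nlinarith [norm_nonneg (x t - y t)]
  exact (sub_eq_zero.1 (norm_eq_zero.1 h1)).symm

lemma mm_gronwall {a : ℝ} (ha : 0 ≤ a) {e b : ℕ → ℝ} {N : ℕ} (hb : ∀ k, 0 ≤ b k)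
    (h : ∀ k < N, e (k + 1) ≤ (1 + a) * e k + b k) :
    ∀ k ≤ N, e k ≤ (1 + a) ^ k * (e 0 + ∑ j ∈ Finset.range k, b j) := by
  intro k
  induction k with
  | zero => intro _; simp
  | succ k ih =>
    intro hk
    have h1 := h k hk
    have h2 := ih (by omega)
    have h3 : (1:ℝ) ≤ (1 + a) ^ (k + 1) := one_le_pow₀ (by linarith)
    have h4 := mul_le_mul_of_nonneg_left h2 (by linarith : 0 ≤ 1 + a)
    have h5 := mul_le_mul_of_nonneg_right h3 (hb k)
    rw [Finset.sum_range_succ]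
    calc e (k+1) ≤ (1 + a) * ((1 + a) ^ k * (e 0 + ∑ j ∈ Finset.range k, b j)) + 1 * b k := by
          linarith
      _ ≤ (1 + a) * ((1 + a) ^ k * (e 0 + ∑ j ∈ Finset.range k, b j)) + (1 + a) ^ (k + 1) * b k := by
          linarith
      _ = _ := by ring

lemma mm_scheme {n : ℕ} {T : ℝ} (hT : 0 < T)
    {A : EuclideanSpace ℝ (Fin n) → Set (EuclideanSpace ℝ (Fin n))} (hA : MaximalMonotone A)
    {f : ℝ → EuclideanSpace ℝ (Fin n) → EuclideanSpace ℝ (Fin n)}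
    (hfII : AssumptionII T f) (hfIII : AssumptionIII T f)
    {x₀ : EuclideanSpace ℝ (Fin n)} (hx₀ : (A x₀).Nonempty) :
    ∃ R C : ℝ, 0 ≤ C ∧ ∀ N : ℕ, 0 < N → ∃ z : ℕ → EuclideanSpace ℝ (Fin n), z 0 = x₀ ∧
      (∀ k : ℕ, (T / N)⁻¹ • (z k + (T / N) • f (k * (T / N)) (z k) - z (k + 1)) ∈ A (z (k + 1))) ∧
      (∀ k ≤ N, ‖z k‖ ≤ R) ∧ ∀ k < N, ‖z (k + 1) - z k‖ ≤ C * (T / N) := by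
  obtain ⟨L, hL, hf⟩ := hfII
  have hx₀' := hx₀
  obtain ⟨a₀, ha₀⟩ := hx₀'
  have hcont : Continuous fun t => f t x₀ - a₀ := (hfIII.1 x₀).continuous.sub continuous_const
  obtain ⟨C₀, hC₀⟩ := isCompact_Icc.exists_bound_of_continuousOn
    (s := Icc 0 T) hcont.continuousOn
  have hC₀0 : 0 ≤ C₀ := (norm_nonneg _).trans (hC₀ 0 ⟨le_rfl, hT.le⟩)
  set R := ‖x₀‖ + Real.exp (L * T) * (T * C₀) with hR
  obtain ⟨M, hM0, hM⟩ := mm_var hT hfIII R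
  refine ⟨R, Real.exp (L * T) * (C₀ + M), by positivity, fun N hN => ?_⟩
  have hN' : (0:ℝ) < N := by exact_mod_cast hN
  have hM := hM N hN
  have hh : 0 < T / N := by positivity
  have hNh : N * (T / N) = T := by field_simp
  set h := T / N with hhdef
  choose J hJ using fun w => mm_resolvent hA hx₀ hh w
  let z : ℕ → EuclideanSpace ℝ (Fin n) := fun k =>
    Nat.rec x₀ (fun k x => J (x + h • f (k * h) x)) k
  have hz0 : z 0 = x₀ := rfl
  have hz : ∀ k : ℕ, h⁻¹ • (z k + h • f (k * h) (z k) - z (k + 1)) ∈ A (z (k + 1)) :=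
    fun k => hJ _
  have htk : ∀ k ≤ N, (k:ℝ) * h ∈ Icc 0 T := by
    intro k hk
    refine ⟨by positivity, ?_⟩
    rw [← hNh]; gcongr
  have hpow : ∀ k ≤ N, (1 + L * h) ^ k ≤ Real.exp (L * T) := by
    intro k hk
    calc (1 + L * h) ^ k ≤ (Real.exp (L * h)) ^ k := by
          gcongr; linarith [Real.add_one_le_exp (L * h)]
      _ = Real.exp (L * (k * h)) := by rw [← Real.exp_nat_mul]; ring_nf
      _ ≤ _ := by
          gcongr
          exact (htk k hk).2
  have h0A : h⁻¹ • (x₀ + h • a₀ - x₀) ∈ A x₀ := by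
    have : h⁻¹ • (x₀ + h • a₀ - x₀) = a₀ := by
      rw [add_sub_cancel_left, smul_smul, inv_mul_cancel₀ hh.ne', one_smul]
    rwa [this]
  have hstep0 : ∀ k < N, ‖z (k + 1) - x₀‖ ≤ (1 + L * h) * ‖z k - x₀‖ + h * C₀ := by
    intro k hk
    have h1 := mm_nonexp hA hh (hz k) h0A
    have e : z k + h • f (k * h) (z k) - (x₀ + h • a₀) =
      (z k - x₀) + h • (f (k * h) (z k) - f (k * h) x₀) + h • (f (k * h) x₀ - a₀) := by module
    rw [e] at h1
    have h2 := norm_add₃_le (a := z k - x₀) (b := h • (f (k * h) (z k) - f (k * h) x₀))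
      (c := h • (f (k * h) x₀ - a₀))
    rw [norm_smul, norm_smul, Real.norm_of_nonneg hh.le] at h2
    have h3 := mul_le_mul_of_nonneg_left (hf _ (htk k hk.le) (z k) x₀) hh.le
    have h4 := mul_le_mul_of_nonneg_left (hC₀ _ (htk k hk.le)) hh.le
    linarith
  have hbd : ∀ k ≤ N, ‖z k‖ ≤ R := by
    intro k hk
    have h1 := mm_gronwall (a := L * h) (by positivity) (e := fun k => ‖z k - x₀‖)
      (b := fun _ => h * C₀) (fun _ => by positivity) hstep0 k hk
    simp only [hz0, sub_self, norm_zero, zero_add, Finset.sum_const, Finset.card_range,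
      nsmul_eq_mul] at h1
    have h2 : (k:ℝ) * (h * C₀) ≤ T * C₀ := by
      rw [← mul_assoc]; exact mul_le_mul_of_nonneg_right (htk k hk).2 hC₀0
    have h3 : (1 + L * h) ^ k * (k * (h * C₀)) ≤ Real.exp (L * T) * (T * C₀) := by
      gcongr
      exact hpow k hk
    have h4 := norm_le_norm_add_norm_sub' (z k) x₀
    rw [hR]; linarith
  refine ⟨z, hz0, hz, hbd, ?_⟩
  have hvar := hM (fun k => z (k + 1)) (fun k hk => hbd (k + 1) hk)
  set β : ℕ → ℝ := fun k => ‖f ((k + 1 : ℕ) * h) (z (k + 1)) - f (k * h) (z (k + 1))‖ with hβ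
  have hstep1 : ∀ k < N - 1, ‖z (k + 1 + 1) - z (k + 1)‖ ≤
      (1 + L * h) * ‖z (k + 1) - z k‖ + h * β k := by
    intro k hk
    have h1 := mm_nonexp hA hh (hz (k + 1)) (hz k)
    have e : z (k + 1) + h • f ((k + 1 : ℕ) * h) (z (k + 1)) - (z k + h • f (k * h) (z k)) =
      (z (k + 1) - z k) + h • (f (k * h) (z (k + 1)) - f (k * h) (z k)) +
      h • (f ((k + 1 : ℕ) * h) (z (k + 1)) - f (k * h) (z (k + 1))) := by module
    rw [e] at h1
    have h2 := norm_add₃_le (a := z (k + 1) - z k)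
      (b := h • (f (k * h) (z (k + 1)) - f (k * h) (z k)))
      (c := h • (f ((k + 1 : ℕ) * h) (z (k + 1)) - f (k * h) (z (k + 1))))
    rw [norm_smul, norm_smul, Real.norm_of_nonneg hh.le] at h2
    have h3 := mul_le_mul_of_nonneg_left (hf _ (htk k (by omega)) (z (k + 1)) (z k)) hh.le
    simp only [hβ]
    linarith
  intro k hk
  have h1 := mm_gronwall (a := L * h) (by positivity) (e := fun k => ‖z (k + 1) - z k‖)
      (b := fun k => h * β k) (fun _ => by positivity) hstep1 k (by omega)
  have h2 : ‖z 1 - z 0‖ ≤ h * C₀ := by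
    have := hstep0 0 hN
    simpa [hz0] using this
  have h3 : ∑ j ∈ Finset.range k, h * β j ≤ h * M := by
    rw [← Finset.mul_sum]
    refine mul_le_mul_of_nonneg_left (le_trans ?_ hvar) hh.le
    exact Finset.sum_le_sum_of_subset_of_nonneg (Finset.range_mono hk.le)
      (fun _ _ _ => norm_nonneg _)
  have h4 : 0 ≤ ∑ j ∈ Finset.range k, h * β j := Finset.sum_nonneg fun _ _ => by positivity
  calc ‖z (k + 1) - z k‖ ≤ _ := h1
    _ ≤ Real.exp (L * T) * (h * C₀ + h * M) := by
        gcongr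
        · exact hpow k hk.le
        · exact h2
    _ = _ := by ring

lemma mm_lip_seq {E : Type*} [NormedAddCommGroup E] {z : ℕ → E} {N : ℕ} {c : ℝ}
    (hz : ∀ k < N, ‖z (k + 1) - z k‖ ≤ c) {i j : ℕ} (hij : i ≤ j) (hj : j ≤ N) :
    ‖z j - z i‖ ≤ c * ((j : ℝ) - i) := by
  induction j, hij using Nat.le_induction with
  | base => simp
  | succ j hij ih =>
    have h1 := hz j hj
    have h2 := ih (by omega)
    have h3 := norm_sub_le_norm_sub_add_norm_sub (z (j + 1)) (z j) (z i)
    push_cast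
    linarith

lemma mm_energy {n : ℕ} {A : EuclideanSpace ℝ (Fin n) → Set (EuclideanSpace ℝ (Fin n))}
    (hA : MaximalMonotone A) {h : ℝ} (hh : 0 < h) {g z : ℕ → EuclideanSpace ℝ (Fin n)}
    (hz : ∀ k : ℕ, h⁻¹ • (z k + h • g k - z (k + 1)) ∈ A (z (k + 1)))
    {y y' : EuclideanSpace ℝ (Fin n)} (hy : y' ∈ A y) {i j : ℕ} (hij : i ≤ j) {c : ℝ}
    (hc : ∀ k, i ≤ k → k < j → ⟪g k - y', z (k + 1) - y⟫ ≤ c) :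
    ‖z j - y‖ ^ 2 / 2 - ‖z i - y‖ ^ 2 / 2 ≤ c * (h * j - h * i) := by
  induction j, hij using Nat.le_induction with
  | base => simp
  | succ j hij ih =>
    have h1 := ih (fun k hk hk' => hc k hk (by omega))
    have h2 := hc j hij (by omega)
    have h3 := hA.1 _ _ _ _ (hz j) hy
    have e : h⁻¹ • (z j + h • g j - z (j + 1)) - y' =
        (g j - y') - h⁻¹ • ((z (j + 1) - y) - (z j - y)) := by
      have : h⁻¹ • h • g j = g j := by rw [smul_smul, inv_mul_cancel₀ hh.ne', one_smul]
      rw [smul_sub, smul_add, this]; module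
    rw [e, inner_sub_left, inner_smul_left, inner_sub_left (z (j + 1) - y), real_inner_self_eq_norm_sq] at h3
    simp only [conj_trivial] at h3
    have h4 := real_inner_le_norm (z j - y) (z (j + 1) - y)
    set P := ‖z (j + 1) - y‖
    set Q := ‖z j - y‖
    have h5 : h⁻¹ * (P ^ 2 / 2 - Q ^ 2 / 2) ≤ c := by
      have hi : 0 < h⁻¹ := by positivity
      have : P ^ 2 / 2 - Q ^ 2 / 2 ≤ P ^ 2 - ⟪z j - y, z (j + 1) - y⟫ := by
        nlinarith [sq_nonneg (P - Q)]
      have := mul_le_mul_of_nonneg_left this hi.le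
      linarith
    rw [inv_mul_le_iff₀ hh] at h5
    push_cast
    linarith

lemma mm_deriv {n : ℕ} {T : ℝ} {L : ℝ}
    {f : ℝ → EuclideanSpace ℝ (Fin n) → EuclideanSpace ℝ (Fin n)}
    (hf : ∀ t ∈ Icc (0 : ℝ) T, ∀ x₁ x₂, ‖f t x₁ - f t x₂‖ ≤ L * ‖x₁ - x₂‖)
    (hc : ∀ x, Continuous fun t => f t x) {s : ℝ} (hs : s ∈ Ioo 0 T)
    (x : EuclideanSpace ℝ (Fin n)) :
    ContinuousAt (fun p : ℝ × EuclideanSpace ℝ (Fin n) => f p.1 p.2) (s, x) := by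
  have hlim : Filter.Tendsto (fun p : ℝ × EuclideanSpace ℝ (Fin n) =>
      L * ‖p.2 - x‖ + ‖f p.1 x - f s x‖) (nhds (s, x)) (nhds 0) := by
    have hcx := hc x
    have : Continuous (fun p : ℝ × EuclideanSpace ℝ (Fin n) =>
      L * ‖p.2 - x‖ + ‖f p.1 x - f s x‖) := by
      have h2 : Continuous fun p : ℝ × EuclideanSpace ℝ (Fin n) => f p.1 x :=
        hcx.comp continuous_fst
      fun_prop
    have h := this.tendsto (s, x)
    simpa using h
  rw [ContinuousAt, tendsto_iff_norm_sub_tendsto_zero]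
  refine squeeze_zero' (Filter.Eventually.of_forall fun _ => norm_nonneg _) ?_ hlim
  have hev : ∀ᶠ p : ℝ × EuclideanSpace ℝ (Fin n) in nhds (s, x), p.1 ∈ Ioo 0 T :=
    continuous_fst.continuousAt.eventually (isOpen_Ioo.mem_nhds hs)
  filter_upwards [hev] with p hp
  have h1 := hf p.1 ⟨hp.1.le, hp.2.le⟩ p.2 x
  have h2 := norm_sub_le_norm_sub_add_norm_sub (f p.1 p.2) (f p.1 x) (f s x)
  linarith

lemma mm_exists {n : ℕ} {T : ℝ} (hT : 0 < T)
    {A : EuclideanSpace ℝ (Fin n) → Set (EuclideanSpace ℝ (Fin n))} (hA : MaximalMonotone A)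
    {f : ℝ → EuclideanSpace ℝ (Fin n) → EuclideanSpace ℝ (Fin n)}
    (hfII : AssumptionII T f) (hfIII : AssumptionIII T f)
    {x₀ : EuclideanSpace ℝ (Fin n)} (hx₀ : (A x₀).Nonempty) :
    ∃ x, IsLipschitzSolution (fun t ξ => {v | ∃ a ∈ A ξ, v = f t ξ - a}) T x₀ x := by
  obtain ⟨R, C, hC, hscheme⟩ := mm_scheme hT hA hfII hfIII hx₀
  choose z hz0 hz hzR hzC using fun N : ℕ => hscheme (N + 1) N.succ_pos
  obtain ⟨L, hL, hf⟩ := hfII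
  set h : ℕ → ℝ := fun N => T / ((N + 1 : ℕ) : ℝ) with hh
  have hpos : ∀ N, 0 < h N := fun N => by simp only [hh]; positivity
  have hNh : ∀ N, ((N + 1 : ℕ) : ℝ) * h N = T := fun N => by
    simp only [hh]; field_simp
  let U : Ultrafilter ℕ := Filter.hyperfilter ℕ
  have hU : (U : Filter ℕ) ≤ Filter.atTop := Nat.hyperfilter_le_atTop
  have hlim0 : Filter.Tendsto h U (nhds 0) := by
    have : Filter.Tendsto h Filter.atTop (nhds 0) := by
      have := (tendsto_const_div_atTop_nhds_zero_nat T).comp (Filter.tendsto_add_atTop_nat 1)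
      exact this
    exact this.mono_left hU
  let ix : ℕ → ℝ → ℕ := fun N t => ⌊t / h N⌋₊
  have ix_le : ∀ N t, 0 ≤ t → h N * ix N t ≤ t := fun N t ht => by
    have := Nat.floor_le (div_nonneg ht (hpos N).le)
    rw [le_div_iff₀ (hpos N)] at this
    rw [mul_comm]; exact this
  have ix_gt : ∀ N t, t - h N ≤ h N * ix N t := fun N t => by
    have := (Nat.lt_floor_add_one (t / h N)).le
    rw [div_le_iff₀ (hpos N)] at this
    simp only [ix]
    linarith
  have ix_N : ∀ N t, t ∈ Icc 0 T → ix N t ≤ N + 1 := fun N t ht => by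
    refine Nat.floor_le_of_le ?_
    rw [div_le_iff₀ (hpos N), hNh]; exact ht.2
  have ix_mono : ∀ N s t, s ≤ t → ix N s ≤ ix N t := fun N s t hst =>
    Nat.floor_mono (by have := (hpos N).le; gcongr)
  have ix_lim : ∀ t, 0 ≤ t → Filter.Tendsto (fun N => h N * ix N t) U (nhds t) := fun t ht => by
    have h1 : Filter.Tendsto (fun N => t - h N) U (nhds t) := by
      simpa using (tendsto_const_nhds (x := t)).sub hlim0
    exact tendsto_of_tendsto_of_tendsto_of_le_of_le h1 tendsto_const_nhds
      (fun N => ix_gt N t) (fun N => ix_le N t ht)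
  have hex : ∀ t, ∃ x, t ∈ Icc 0 T → Filter.Tendsto (fun N => z N (ix N t)) U (nhds x) := by
    intro t
    by_cases ht : t ∈ Icc 0 T
    · obtain ⟨x, -, hx⟩ := (isCompact_closedBall (0 : EuclideanSpace ℝ (Fin n)) R).ultrafilter_le_nhds
        (U.map fun N => z N (ix N t)) (by
          rw [Filter.le_principal_iff]
          refine Filter.mem_map.2 (Filter.univ_mem' fun N => ?_)
          simpa using hzR N _ (ix_N N t ht))
      exact ⟨x, fun _ => hx⟩
    · exact ⟨0, fun h => absurd h ht⟩
  choose x hx using hex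
  have hseq : ∀ N s t, s ∈ Icc 0 T → t ∈ Icc 0 T → s ≤ t →
      ∀ k, ix N s ≤ k → k ≤ ix N t → ‖z N k - z N (ix N s)‖ ≤ C * (t - s + h N) := by
    intro N s t hs ht hst k hk1 hk2
    have h1 := mm_lip_seq (hzC N) hk1 (hk2.trans (ix_N N t ht))
    refine h1.trans ?_
    rw [mul_assoc]
    refine mul_le_mul_of_nonneg_left ?_ hC
    change h N * ((k : ℝ) - ix N s) ≤ _
    have h2 := ix_gt N s
    have h3 := ix_le N t ht.1
    have h4 : h N * (k : ℝ) ≤ h N * ix N t :=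
      mul_le_mul_of_nonneg_left (by exact_mod_cast hk2) (hpos N).le
    linarith
  have hlip : ∀ s t, s ∈ Icc 0 T → t ∈ Icc 0 T → s ≤ t → ‖x t - x s‖ ≤ C * (t - s) := by
    intro s t hs ht hst
    have h1 : Filter.Tendsto (fun N => ‖z N (ix N t) - z N (ix N s)‖) U (nhds ‖x t - x s‖) :=
      ((hx t ht).sub (hx s hs)).norm
    have h2 : Filter.Tendsto (fun N => C * (t - s + h N)) U (nhds (C * (t - s + 0))) :=
      (tendsto_const_nhds.add hlim0).const_mul C
    rw [add_zero] at h2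
    exact le_of_tendsto_of_tendsto' h1 h2 fun N =>
      hseq N s t hs ht hst _ (ix_mono N s t hst) le_rfl
  have hlipOn : LipschitzOnWith (Real.toNNReal C) x (Icc 0 T) := by
    refine LipschitzOnWith.of_dist_le_mul fun a ha b hb => ?_
    rw [Real.coe_toNNReal C hC]
    rcases le_total a b with hab | hab
    · rw [dist_comm, dist_comm a b, dist_eq_norm, Real.dist_eq, abs_of_nonneg (by linarith)]
      exact hlip a b ha hb hab
    · rw [dist_eq_norm, Real.dist_eq, abs_of_nonneg (by linarith)]
      exact hlip b a hb ha hab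
  refine ⟨x, ⟨_, hlipOn⟩, ?_, ?_⟩
  · have h1 := hx 0 ⟨le_rfl, hT.le⟩
    have h2 : (fun N => z N (ix N 0)) = fun _ => x₀ := by
      funext N; simp [ix, hz0]
    rw [h2] at h1
    exact tendsto_nhds_unique h1 tendsto_const_nhds
  filter_upwards [hlipOn.ae_differentiableWithinAt_of_mem_real] with s hsd hs
  have hs' : s ∈ Icc 0 T := ⟨hs.1.le, hs.2.le⟩
  have hd : HasDerivAt x (deriv x s) s :=
    ((hsd hs').differentiableAt (Icc_mem_nhds hs.1 hs.2)).hasDerivAt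
  refine ⟨deriv x s, ⟨f s (x s) - deriv x s, ?_, by abel⟩, hd⟩
  set v := deriv x s
  refine hA.2 _ _ fun y y' hy => ?_
  set c := ⟪f s (x s) - y', x s - y⟫ with hcdef
  suffices hsuff : ∀ ε > 0, ⟪x s - y, v⟫ ≤ c + ε by
    have := le_of_forall_pos_le_add hsuff
    have e : f s (x s) - v - y' = (f s (x s) - y') - v := by abel
    rw [e, inner_sub_left, real_inner_comm (x s - y) v]
    linarith
  intro ε hε
  have hcont : ContinuousAt (fun p : (ℝ × EuclideanSpace ℝ (Fin n)) × EuclideanSpace ℝ (Fin n) =>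
      ⟪f p.1.1 p.1.2 - y', p.2 - y⟫) ((s, x s), x s) := by
    have h1 : ContinuousAt (fun p : (ℝ × EuclideanSpace ℝ (Fin n)) × EuclideanSpace ℝ (Fin n) =>
        f p.1.1 p.1.2) ((s, x s), x s) :=
      ContinuousAt.comp (f := fun p : (ℝ × EuclideanSpace ℝ (Fin n)) × EuclideanSpace ℝ (Fin n) => p.1)
        (g := fun p : ℝ × EuclideanSpace ℝ (Fin n) => f p.1 p.2)
        (mm_deriv hf (fun x => (hfIII.1 x).continuous) hs (x s)) continuous_fst.continuousAt
    exact ContinuousAt.inner (𝕜 := ℝ) (h1.sub continuousAt_const) (continuous_snd.continuousAt.sub continuousAt_const)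
  have hev := hcont.eventually (gt_mem_nhds (show c < c + ε by linarith))
  obtain ⟨δ, hδ, hball⟩ := Metric.eventually_nhds_iff.1 hev
  have hloc : ∀ᶠ t in nhdsWithin s (Ioi s),
      ‖x t - y‖ ^ 2 / 2 - ‖x s - y‖ ^ 2 / 2 ≤ (c + ε) * (t - s) := by
    have e1 : ∀ᶠ t in nhds s, t < T := gt_mem_nhds hs.2
    have e2 : ∀ᶠ t in nhds s, t - s < δ :=
      (by fun_prop : ContinuousAt (fun t : ℝ => t - s) s).eventually
        (gt_mem_nhds (by simpa using hδ))
    have e3 : ∀ᶠ t in nhds s, C * (t - s) < δ / 2 :=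
      (by fun_prop : ContinuousAt (fun t : ℝ => C * (t - s)) s).eventually
        (gt_mem_nhds (by simpa using hδ))
    filter_upwards [self_mem_nhdsWithin, nhdsWithin_le_nhds e1, nhdsWithin_le_nhds e2,
      nhdsWithin_le_nhds e3] with t hst htT ht2 ht3
    have hst : s < t := hst
    have ht : t ∈ Icc 0 T := ⟨hs.1.le.trans hst.le, htT.le⟩
    have l1 : Filter.Tendsto (fun N => ‖z N (ix N t) - y‖ ^ 2 / 2 - ‖z N (ix N s) - y‖ ^ 2 / 2) U
        (nhds (‖x t - y‖ ^ 2 / 2 - ‖x s - y‖ ^ 2 / 2)) :=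
      ((((hx t ht).sub_const y).norm.pow 2).div_const 2).sub
        ((((hx s hs').sub_const y).norm.pow 2).div_const 2)
    have l2 : Filter.Tendsto (fun N => (c + ε) * (h N * ix N t - h N * ix N s)) U
        (nhds ((c + ε) * (t - s))) :=
      ((ix_lim t ht.1).sub (ix_lim s hs'.1)).const_mul _
    refine le_of_tendsto_of_tendsto l1 l2 ?_
    have u1 : ∀ᶠ N in (U : Filter ℕ), h N < δ := hlim0.eventually (gt_mem_nhds hδ)
    have u2 : ∀ᶠ N in (U : Filter ℕ),
        C * (t - s + h N) + ‖z N (ix N s) - x s‖ < δ := by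
      have l3 : Filter.Tendsto (fun N => C * (t - s + h N) + ‖z N (ix N s) - x s‖) U
          (nhds (C * (t - s + 0) + ‖x s - x s‖)) :=
        ((tendsto_const_nhds.add hlim0).const_mul C).add ((hx s hs').sub_const (x s)).norm
      refine l3.eventually (gt_mem_nhds ?_)
      rw [add_zero, sub_self, norm_zero]; linarith
    filter_upwards [u1, u2] with N hN1 hN2
    refine mm_energy hA (hpos N) (g := fun k => f (k * h N) (z N k)) (fun k => hz N k) hy
      (ix_mono N s t hst.le) (fun k hk1 hk2 => ?_)
    have hnear : ∀ k, ix N s ≤ k → k ≤ ix N t → dist (z N k) (x s) < δ := by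
      intro k hk1 hk2
      rw [dist_eq_norm]
      have h1 := hseq N s t hs' ht hst.le k hk1 hk2
      have h2 := norm_sub_le_norm_sub_add_norm_sub (z N k) (z N (ix N s)) (x s)
      linarith
    refine le_of_lt (hball (y := ((k * h N, z N k), z N (k + 1))) ?_)
    rw [Prod.dist_eq, Prod.dist_eq]
    refine max_lt (max_lt ?_ (hnear k hk1 hk2.le)) (hnear (k + 1) (by omega) hk2)
    rw [Real.dist_eq, abs_lt]
    have h1 := ix_gt N s
    have h2 := ix_le N t ht.1
    have h3 : h N * (ix N s : ℝ) ≤ h N * k :=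
      mul_le_mul_of_nonneg_left (by exact_mod_cast hk1) (hpos N).le
    have h4 : h N * (k : ℝ) ≤ h N * ix N t :=
      mul_le_mul_of_nonneg_left (by exact_mod_cast hk2.le) (hpos N).le
    constructor <;> simp only <;> linarith
  have hψ : HasDerivAt (fun t => ‖x t - y‖ ^ 2 / 2) (⟪x s - y, v⟫) s := by
    have := ((hd.sub_const y).norm_sq).div_const 2
    simpa using this
  have hslope := (hasDerivAt_iff_tendsto_slope.1 hψ).mono_left
    (nhdsWithin_mono s (show Ioi s ⊆ {s}ᶜ from fun t ht => ne_of_gt ht))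
  refine le_of_tendsto hslope ?_
  filter_upwards [hloc, self_mem_nhdsWithin] with t h1 h2
  have h2 : s < t := h2
  rw [slope_def_field, div_le_iff₀ (by linarith)]
  exact h1

/-- Existence and uniqueness of a Lipschitz solution of the differential inclusion
`ẋ(t) ∈ -A(x(t)) + f(t, x(t))`, `x(0) = x₀ ∈ D(A)`, for `A` maximal monotone and `f`
satisfying Assumptions (ii) and (iii). -/
theorem maximalMonotone_inclusion_existsUnique_lipschitzSolution
    (n : ℕ) (T : ℝ) (hT : 0 < T)
    (A : EuclideanSpace ℝ (Fin n) → Set (EuclideanSpace ℝ (Fin n)))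
    (hA : MaximalMonotone A)
    (f : ℝ → EuclideanSpace ℝ (Fin n) → EuclideanSpace ℝ (Fin n))
    (hfII : AssumptionII T f) (hfIII : AssumptionIII T f)
    (x₀ : EuclideanSpace ℝ (Fin n)) (hx₀ : (A x₀).Nonempty) :
    ∃ x : ℝ → EuclideanSpace ℝ (Fin n),
      IsLipschitzSolution (fun t ξ => {v | ∃ a ∈ A ξ, v = f t ξ - a}) T x₀ x ∧
      ∀ y : ℝ → EuclideanSpace ℝ (Fin n),
        IsLipschitzSolution (fun t ξ => {v | ∃ a ∈ A ξ, v = f t ξ - a}) T x₀ y →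
        ∀ t ∈ Icc (0 : ℝ) T, y t = x t := by
  obtain ⟨x, hx⟩ := mm_exists hT hA hfII hfIII hx₀
  exact ⟨x, hx, fun y hy => mm_unique hA hfII hx hy⟩
end
end

section
/- Let A : ℝⁿ ⇉ ℝⁿ be a maximal monotone operator with domain D(A), let f : [0,T] × ℝⁿ → ℝⁿ satisfy Assumptions (ii) and (iii), let x₀ ∈ D(A), and let x : [0,T] → ℝⁿ be the unique Lipschitz solution of ẋ(t) ∈ -A(x(t)) + f(t, x(t)), x(0) = x₀. Then there exists η > 0 such that for every integer N ≥ 1, setting h = T/N and t_k = k·h, every sequence (x_k)_{0≤k≤N} satisfying x_0 = x₀ and f(t_k, x_k) - (x_{k+1} - x_k)/h ∈ A(x_{k+1}) for all 0 ≤ k ≤ N-1 satisfies ‖x(t_k) - x_k‖ ≤ η·√h for all 0 ≤ k ≤ N (i.e. the backward Euler scheme converges with order at least 1/2). -/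
open MeasureTheory Set
open scoped RealInnerProductSpace

noncomputable section

lemma aux_growth {φ : ℝ → ℝ} {a b D : ℝ} {C : NNReal} (hab : a ≤ b)
    (hφ : LipschitzOnWith C φ (Icc a b))
    (hd : ∀ᵐ t ∂volume, t ∈ Ioo a b → ∃ v, v ≤ D ∧ HasDerivAt φ v t) :
    φ b - φ a ≤ D * (b - a) := by
  have hac : AbsolutelyContinuousOnInterval φ a b := by
    apply LipschitzOnWith.absolutelyContinuousOnInterval (K := C)
    rwa [uIcc_of_le hab]
  rw [← hac.integral_deriv_eq_sub]
  have h1 : ∫ t in a..b, deriv φ t ≤ ∫ _t in a..b, D := by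
    apply intervalIntegral.integral_mono_ae_restrict hab hac.intervalIntegrable_deriv
      intervalIntegrable_const
    rw [← restrict_Ioo_eq_restrict_Icc]
    refine (ae_restrict_iff' measurableSet_Ioo).2 ?_
    filter_upwards [hd] with t ht htm
    obtain ⟨v, hv, hvd⟩ := ht htm
    rw [hvd.deriv]; exact hv
  refine h1.trans ?_
  simp [mul_comm]

lemma aux_holder {n : ℕ} {T : ℝ} {f : ℝ → EuclideanSpace ℝ (Fin n) → EuclideanSpace ℝ (Fin n)}
    (hf : AssumptionIII T f) (R : ℝ) (hR : 0 ≤ R) :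
    ∃ M : ℝ, 0 ≤ M ∧ ∀ c : EuclideanSpace ℝ (Fin n), ‖c‖ ≤ R → ∀ a b : ℝ, 0 ≤ a → a ≤ b → b ≤ T →
      ‖f b c - f a c‖ ≤ M * Real.sqrt (b - a) := by
  obtain ⟨hdiff, hM⟩ := hf
  obtain ⟨M, hM⟩ := hM (R * Real.sqrt T) (by positivity)
  refine ⟨max M 0, le_max_right _ _, fun c hc a b ha hab hb => ?_⟩
  have hT : 0 ≤ T := ha.trans (hab.trans hb)
  have h1 := hM (fun _ => c) (by
    rw [eLpNorm_const' c (by norm_num) (by norm_num)]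
    rw [ENNReal.ofReal_mul hR, Measure.restrict_apply_univ, Real.volume_Ioo, sub_zero,
      Real.sqrt_eq_rpow, ← ENNReal.ofReal_rpow_of_nonneg hT (by norm_num)]
    have e0 : (1 : ℝ) / ENNReal.toReal 2 = 1 / 2 := by simp
    rw [e0]
    gcongr
    rw [← ofReal_norm]; exact ENNReal.ofReal_le_ofReal hc)
  set g := deriv (fun τ => f τ c) with hg
  have hgm : ∀ μ : Measure ℝ, AEStronglyMeasurable g μ := fun μ =>
    (stronglyMeasurable_deriv _).aestronglyMeasurable
  have h2 : eLpNorm g 2 (volume.restrict (Ioo a b)) ≤ ENNReal.ofReal (max M 0) :=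
    (eLpNorm_mono_measure _ (Measure.restrict_mono (Ioo_subset_Ioo ha hb) le_rfl)).trans
      (h1.trans (ENNReal.ofReal_le_ofReal (le_max_left _ _)))
  have h3 : eLpNorm g 1 (volume.restrict (Ioo a b)) ≤
      ENNReal.ofReal (max M 0 * Real.sqrt (b - a)) := by
    refine (eLpNorm_le_eLpNorm_mul_rpow_measure_univ (p := 1) (q := 2) (by norm_num)
      (hgm _)).trans ?_
    rw [ENNReal.ofReal_mul (le_max_right _ _), Measure.restrict_apply_univ, Real.volume_Ioo,
      Real.sqrt_eq_rpow, ← ENNReal.ofReal_rpow_of_nonneg (sub_nonneg.2 hab) (by norm_num)]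
    have e0 : (1 : ℝ) / ENNReal.toReal 1 - 1 / ENNReal.toReal 2 = 1 / 2 := by
      simp; norm_num
    rw [e0]
    gcongr
  have hint : Integrable g (volume.restrict (Ioo a b)) :=
    memLp_one_iff_integrable.1 ⟨hgm _, h3.trans_lt ENNReal.ofReal_lt_top⟩
  have hII : IntervalIntegrable g volume a b := by
    rw [intervalIntegrable_iff_integrableOn_Ioo_of_le hab]; exact hint
  have h4 : ∫ t in a..b, g t = f b c - f a c :=
    intervalIntegral.integral_deriv_eq_sub (fun t _ => hdiff c t) hII
  rw [← h4, intervalIntegral.integral_of_le hab, integral_Ioc_eq_integral_Ioo]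
  have h5 := (enorm_integral_le_lintegral_enorm (μ := volume.restrict (Ioo a b)) g)
  rw [← eLpNorm_one_eq_lintegral_enorm] at h5
  have h6 := h5.trans h3
  rw [← ofReal_norm] at h6
  exact (ENNReal.ofReal_le_ofReal_iff (by positivity)).1 h6

lemma aux_alg {e d p E' h s B K L C1 T : ℝ} (he : 0 ≤ e) (hh : 0 < h) (hs : s ^ 2 = h)
    (hhT : h ≤ T) (hB0 : 0 ≤ B) (hB : B ≤ C1 * s + L * e) (hL : 0 ≤ L)
    (hE : E' - (e ^ 2 - 2 * p + d ^ 2) ≤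
      2 * (B * (e + d + K * h) + h⁻¹ * (p - d ^ 2 + d * (K * h))) * h) :
    E' ≤ (1 + (1 + 2 * L + 6 * T * L ^ 2 + C1 ^ 2 + 3 * K ^ 2 + 6 * C1 ^ 2 * T) * h) * e ^ 2 +
      (1 + 2 * L + 6 * T * L ^ 2 + C1 ^ 2 + 3 * K ^ 2 + 6 * C1 ^ 2 * T) * h ^ 2 := by
  have hT : 0 < T := hh.trans_le hhT
  have e1 : 2 * (B * (e + d + K * h) + h⁻¹ * (p - d ^ 2 + d * (K * h))) * h =
      2 * h * B * (e + d + K * h) + 2 * (p - d ^ 2 + d * (K * h)) := by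
    field_simp
  rw [e1] at hE
  have s1 : E' ≤ e ^ 2 + h ^ 2 * (3 * K ^ 2 + 3 * B ^ 2) + 2 * h * (B * e) := by
    nlinarith [sq_nonneg (d - h * (K + B)), sq_nonneg (h * (K - B))]
  have s2 : B ^ 2 ≤ 2 * C1 ^ 2 * h + 2 * L ^ 2 * e ^ 2 := by
    have : B ^ 2 ≤ (C1 * s + L * e) ^ 2 := by gcongr
    rw [← hs]; nlinarith [sq_nonneg (C1 * s - L * e)]
  have s3 : 2 * (B * e) ≤ C1 ^ 2 * h + (1 + 2 * L) * e ^ 2 := by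
    have : B * e ≤ (C1 * s + L * e) * e := by gcongr
    rw [← hs]; nlinarith [sq_nonneg (C1 * s - e)]
  have s4 : E' ≤ e ^ 2 + h ^ 2 * (3 * K ^ 2 + 3 * (2 * C1 ^ 2 * h + 2 * L ^ 2 * e ^ 2)) +
      h * (C1 ^ 2 * h + (1 + 2 * L) * e ^ 2) := by
    have a1 : h ^ 2 * (3 * K ^ 2 + 3 * B ^ 2) ≤
      h ^ 2 * (3 * K ^ 2 + 3 * (2 * C1 ^ 2 * h + 2 * L ^ 2 * e ^ 2)) := by gcongr
    have a2 := mul_le_mul_of_nonneg_left s3 hh.le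
    linarith
  have b1 : h ^ 2 * (C1 ^ 2 * h) ≤ h ^ 2 * (C1 ^ 2 * T) := by gcongr
  have b2 : h * (h * (L ^ 2 * e ^ 2)) ≤ h * (T * (L ^ 2 * e ^ 2)) := by gcongr
  have b3 : 0 ≤ (C1 ^ 2 + 3 * K ^ 2 + 6 * C1 ^ 2 * T) * h * e ^ 2 := by positivity
  have b4 : 0 ≤ (1 + 2 * L + 6 * T * L ^ 2) * h ^ 2 := by positivity
  nlinarith

lemma aux_gronwall {E : ℕ → ℝ} {C h : ℝ} (hC : 0 ≤ C) (hh : 0 ≤ h) (N : ℕ) (h0 : E 0 = 0)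
    (hE : ∀ k, k < N → E (k + 1) ≤ (1 + C * h) * E k + C * h ^ 2) :
    ∀ k, k ≤ N → E k ≤ h * Real.exp (C * (k * h)) := by
  have key : ∀ k, k ≤ N → E k ≤ h * ((1 + C * h) ^ k - 1) := by
    intro k
    induction k with
    | zero => intro _; simp [h0]
    | succ k ih =>
      intro hk
      refine (hE k (by omega)).trans ?_
      have := mul_le_mul_of_nonneg_left (ih (by omega)) (by positivity : 0 ≤ 1 + C * h)
      rw [pow_succ (1 + C * h) k]; linarith
  intro k hk
  refine (key k hk).trans ?_
  gcongr
  have h1 : (1 + C * h) ^ k ≤ Real.exp (C * h) ^ k := by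
    gcongr
    linarith [Real.add_one_le_exp (C * h)]
  rw [← Real.exp_nat_mul] at h1
  have : (k : ℝ) * (C * h) = C * (k * h) := by ring
  rw [this] at h1
  linarith

lemma aux_step {n : ℕ} {T a b L M R s : ℝ} {K : NNReal}
    {A : EuclideanSpace ℝ (Fin n) → Set (EuclideanSpace ℝ (Fin n))}
    (hA : ∀ x y x' y' : EuclideanSpace ℝ (Fin n), x' ∈ A x → y' ∈ A y → 0 ≤ ⟪x' - y', x - y⟫)
    {f : ℝ → EuclideanSpace ℝ (Fin n) → EuclideanSpace ℝ (Fin n)}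
    (ha : 0 ≤ a) (hab : a < b) (hb : b ≤ T) (hL : 0 ≤ L) (hM : 0 ≤ M)
    (hfL : ∀ t ∈ Icc (0 : ℝ) T, ∀ x₁ x₂, ‖f t x₁ - f t x₂‖ ≤ L * ‖x₁ - x₂‖)
    (hfM : ∀ c : EuclideanSpace ℝ (Fin n), ‖c‖ ≤ R → ∀ a b : ℝ, 0 ≤ a → a ≤ b → b ≤ T →
      ‖f b c - f a c‖ ≤ M * Real.sqrt (b - a))
    {x : ℝ → EuclideanSpace ℝ (Fin n)}
    (hxK : LipschitzOnWith K x (Icc 0 T)) (hxR : ∀ t ∈ Icc 0 T, ‖x t‖ ≤ R)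
    (hx : ∀ᵐ t ∂volume, t ∈ Ioo 0 T → ∃ v, (∃ a ∈ A (x t), v = f t (x t) - a) ∧ HasDerivAt x v t)
    (hs : s = Real.sqrt (b - a))
    (y z : EuclideanSpace ℝ (Fin n)) (hz : f a y - (b - a)⁻¹ • (z - y) ∈ A z) :
    ‖x b - z‖ ^ 2 - (‖x a - y‖ ^ 2 - 2 * ⟪z - y, x a - y⟫ + ‖z - y‖ ^ 2) ≤
      2 * ((M * s + L * K * (b - a) + L * ‖x a - y‖) * (‖x a - y‖ + ‖z - y‖ + K * (b - a)) +
        (b - a)⁻¹ * (⟪z - y, x a - y⟫ - ‖z - y‖ ^ 2 + ‖z - y‖ * (K * (b - a)))) * (b - a) := by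
  have hh : 0 < b - a := sub_pos.2 hab
  have hxa : ‖x a - z‖ ^ 2 = ‖x a - y‖ ^ 2 - 2 * ⟪z - y, x a - y⟫ + ‖z - y‖ ^ 2 := by
    have : x a - z = (x a - y) - (z - y) := by abel
    rw [this, norm_sub_sq_real, real_inner_comm]
  rw [← hxa]
  have hsub : Icc a b ⊆ Icc 0 T := Icc_subset_Icc ha hb
  have haT : a ∈ Icc 0 T := hsub (left_mem_Icc.2 hab.le)
  have hR : 0 ≤ R := (norm_nonneg _).trans (hxR a haT)
  refine aux_growth (φ := fun t => ‖x t - z‖ ^ 2)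
    (C := ⟨2 * (R + ‖z‖) * K, by positivity⟩) hab.le ?_ ?_
  · apply LipschitzOnWith.of_dist_le_mul
    intro t ht u hu
    have h1 := hxK.dist_le_mul t (hsub ht) u (hsub hu)
    have h2 : ‖x t - z‖ ≤ R + ‖z‖ := (norm_sub_le _ _).trans (by linarith [hxR t (hsub ht)])
    have h3 : ‖x u - z‖ ≤ R + ‖z‖ := (norm_sub_le _ _).trans (by linarith [hxR u (hsub hu)])
    have h4 : |‖x t - z‖ - ‖x u - z‖| ≤ dist (x t) (x u) := by
      refine (abs_norm_sub_norm_le _ _).trans ?_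
      rw [dist_eq_norm]; simp
    rw [Real.dist_eq, sq_sub_sq, abs_mul]
    have h5 : |‖x t - z‖ + ‖x u - z‖| ≤ 2 * (R + ‖z‖) := by
      rw [abs_of_nonneg (by positivity)]; linarith
    calc _ ≤ (2 * (R + ‖z‖)) * (K * dist t u) :=
          mul_le_mul h5 (h4.trans h1) (abs_nonneg _) (by positivity)
      _ = (2 * (R + ‖z‖) * K) * dist t u := by ring
  · filter_upwards [hx] with t ht htm
    have htT : t ∈ Icc 0 T := hsub (Ioo_subset_Icc_self htm)
    obtain ⟨v, ⟨α, hα, rfl⟩, hd⟩ := ht ⟨ha.trans_lt htm.1, htm.2.trans_le hb⟩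
    refine ⟨_, ?_, (hd.sub_const z).norm_sq⟩
    have hmon := hA _ _ _ _ hα hz
    have hdx : ‖x t - x a‖ ≤ K * (b - a) := by
      have := hxK.dist_le_mul t htT a haT
      rw [dist_eq_norm, Real.dist_eq, abs_of_pos (sub_pos.2 htm.1)] at this
      refine this.trans ?_
      gcongr
      exact htm.2.le
    have hsplit : ⟪x t - z, f t (x t) - α⟫ =
        ⟪f t (x t) - f a y, x t - z⟫ + (b - a)⁻¹ * (⟪z - y, x a - y⟫ - ‖z - y‖ ^ 2
          + ⟪z - y, x t - x a⟫) - ⟪α - (f a y - (b - a)⁻¹ • (z - y)), x t - z⟫ := by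
      have e1 : ⟪z - y, x a - y⟫ - ‖z - y‖ ^ 2 + ⟪z - y, x t - x a⟫ = ⟪z - y, x t - z⟫ := by
        rw [← real_inner_self_eq_norm_sq, ← inner_sub_right, ← inner_add_right]
        congr 1; abel
      rw [e1, ← real_inner_smul_left, ← inner_add_left, ← inner_sub_left, real_inner_comm]
      congr 1; abel
    have hF : ‖f t (x t) - f a y‖ ≤ M * s + L * K * (b - a) + L * ‖x a - y‖ := by
      have e1 : f t (x t) - f a y = (f t (x t) - f a (x t)) + (f a (x t) - f a y) := by abel
      have e2 := hfM (x t) (hxR t htT) a t ha htm.1.le htT.2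
      have e3 := hfL a haT (x t) y
      have e4 : ‖x t - y‖ ≤ K * (b - a) + ‖x a - y‖ := by
        have : x t - y = (x t - x a) + (x a - y) := by abel
        rw [this]; exact (norm_add_le _ _).trans (by linarith)
      have e5 : M * Real.sqrt (t - a) ≤ M * s := by
        rw [hs]; gcongr; exact htm.2.le
      have e6 := mul_le_mul_of_nonneg_left e4 hL
      rw [e1]; refine (norm_add_le _ _).trans ?_
      nlinarith
    have hX : ‖x t - z‖ ≤ ‖x a - y‖ + ‖z - y‖ + K * (b - a) := by
      have : x t - z = (x a - y) - (z - y) + (x t - x a) := by abel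
      rw [this]
      exact (norm_add_le _ _).trans (add_le_add (norm_sub_le _ _) hdx)
    have h1 : ⟪f t (x t) - f a y, x t - z⟫ ≤ (M * s + L * K * (b - a) + L * ‖x a - y‖) *
        (‖x a - y‖ + ‖z - y‖ + K * (b - a)) :=
      (real_inner_le_norm _ _).trans
        (mul_le_mul hF hX (norm_nonneg _) ((norm_nonneg _).trans hF))
    have h2 : ⟪z - y, x t - x a⟫ ≤ ‖z - y‖ * (K * (b - a)) :=
      (real_inner_le_norm _ _).trans (by gcongr)
    have h3 : (b - a)⁻¹ * (⟪z - y, x a - y⟫ - ‖z - y‖ ^ 2 + ⟪z - y, x t - x a⟫) ≤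
      (b - a)⁻¹ * (⟪z - y, x a - y⟫ - ‖z - y‖ ^ 2 + ‖z - y‖ * (K * (b - a))) := by gcongr
    rw [hsplit]
    linarith

/-- Convergence with order at least `1/2` of the backward Euler scheme for the maximal
monotone differential inclusion `ẋ(t) ∈ -A(x(t)) + f(t, x(t))`, `x(0) = x₀ ∈ D(A)`:
there is `η > 0` such that for every `N ≥ 1` (with `h = T/N`, `t_k = k·h`), every backward
Euler sequence satisfies `‖x(t_k) - x_k‖ ≤ η·√h` for all `0 ≤ k ≤ N`. -/
theorem backwardEuler_maximalMonotone_order_one_half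
    (n : ℕ) (T : ℝ) (hT : 0 < T)
    (A : EuclideanSpace ℝ (Fin n) → Set (EuclideanSpace ℝ (Fin n)))
    (hA : MaximalMonotone A)
    (f : ℝ → EuclideanSpace ℝ (Fin n) → EuclideanSpace ℝ (Fin n))
    (hfII : AssumptionII T f) (hfIII : AssumptionIII T f)
    (x₀ : EuclideanSpace ℝ (Fin n)) (hx₀ : (A x₀).Nonempty)
    (x : ℝ → EuclideanSpace ℝ (Fin n))
    (hx : IsLipschitzSolution (fun t ξ => {v | ∃ a ∈ A ξ, v = f t ξ - a}) T x₀ x) :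
    ∃ η : ℝ, 0 < η ∧ ∀ N : ℕ, 1 ≤ N →
      ∀ xk : ℕ → EuclideanSpace ℝ (Fin n), xk 0 = x₀ →
        (∀ k : ℕ, k < N →
          f ((k : ℝ) * (T / N)) (xk k) - (T / N)⁻¹ • (xk (k + 1) - xk k) ∈ A (xk (k + 1))) →
        ∀ k : ℕ, k ≤ N → ‖x ((k : ℝ) * (T / N)) - xk k‖ ≤ η * Real.sqrt (T / N) := by
  obtain ⟨L, hL, hfL⟩ := hfII
  obtain ⟨⟨K, hxK⟩, hx0, hxd⟩ := hx
  have hxR : ∀ t ∈ Icc 0 T, ‖x t‖ ≤ ‖x₀‖ + K * T := by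
    intro t ht
    have h1 := hxK.dist_le_mul t ht 0 ⟨le_rfl, hT.le⟩
    rw [dist_eq_norm, hx0, Real.dist_eq, sub_zero, abs_of_nonneg ht.1] at h1
    have h2 : (K : ℝ) * t ≤ K * T := by gcongr; exact ht.2
    have h3 := norm_sub_norm_le (x t) x₀
    linarith
  obtain ⟨M, hM, hfM⟩ := aux_holder hfIII (‖x₀‖ + K * T) (by positivity)
  set C1 : ℝ := M + L * K * Real.sqrt T with hC1
  set C : ℝ := 1 + 2 * L + 6 * T * L ^ 2 + C1 ^ 2 + 3 * (K : ℝ) ^ 2 + 6 * C1 ^ 2 * T with hC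
  have hC0 : 0 ≤ C := by positivity
  refine ⟨Real.sqrt (Real.exp (C * T)), Real.sqrt_pos.2 (Real.exp_pos _), ?_⟩
  intro N hN xk hxk0 hxk k hk
  have hN0 : (0 : ℝ) < N := by exact_mod_cast hN
  set h : ℝ := T / N with hh
  have hh0 : 0 < h := by positivity
  have hNh : (N : ℝ) * h = T := by rw [hh]; field_simp
  have hhT : h ≤ T := by
    have : (1 : ℝ) ≤ N := by exact_mod_cast hN
    rw [← hNh]; nlinarith
  have hkT : ∀ j : ℕ, j ≤ N → (j : ℝ) * h ≤ T := by
    intro j hj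
    rw [← hNh]; gcongr
  have hG := aux_gronwall (E := fun j => ‖x ((j : ℝ) * h) - xk j‖ ^ 2) hC0 hh0.le N
    (by simp [hx0, hxk0]) (by
      intro j hj
      have hb : ((j + 1 : ℕ) : ℝ) * h - (j : ℝ) * h = h := by push_cast; ring
      have hst := aux_step (a := (j : ℝ) * h) (b := ((j + 1 : ℕ) : ℝ) * h) (s := Real.sqrt h)
        hA.1 (by positivity) (by linarith) (hkT _ hj) hL hM hfL hfM hxK hxR hxd
        (by rw [hb]) (xk j) (xk (j + 1)) (by rw [hb]; exact hxk j hj)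
      rw [hb] at hst
      refine aux_alg (norm_nonneg _) hh0 (Real.sq_sqrt hh0.le) hhT (by positivity) ?_ hL hst
      have e1 : h ≤ Real.sqrt T * Real.sqrt h := by
        calc h = Real.sqrt h * Real.sqrt h := (Real.mul_self_sqrt hh0.le).symm
          _ ≤ _ := by gcongr
      have e2 : L * K * h ≤ L * K * (Real.sqrt T * Real.sqrt h) := by gcongr
      rw [hC1]; nlinarith)
  have h1 : ‖x ((k : ℝ) * h) - xk k‖ ^ 2 ≤ Real.exp (C * T) * h := by
    refine (hG k hk).trans ?_
    rw [mul_comm]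
    gcongr
    exact hkT k hk
  rw [← Real.sqrt_mul (Real.exp_pos _).le]
  exact Real.le_sqrt_of_sq_le h1
end
end

section
/- The set-valued map F : ℝ ⇉ ℝ defined by F(x) = {(x+1)·σ : σ ∈ sgn(x)} is hypomonotone with constant k for every k ≥ 1; that is, for all x, y ∈ ℝ, u ∈ F(x) and v ∈ F(y), one has (u - v)·(x - y) ≥ -k·(x - y)². -/
open Set

noncomputable section

/-- The set-valued map `x ↦ (x+1)·sgn(x)` is hypomonotone with constant `k` for every
`k ≥ 1`. -/
theorem hypomonotone_mul_sgn (k : ℝ) (hk : 1 ≤ k) (x y u v : ℝ)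
    (hu : ∃ σ ∈ sgnSet x, u = (x + 1) * σ)
    (hv : ∃ τ ∈ sgnSet y, v = (y + 1) * τ) :
    -(k * (x - y) ^ 2) ≤ (u - v) * (x - y) := by
  obtain ⟨σ, hσ, rfl⟩ := hu
  obtain ⟨τ, hτ, rfl⟩ := hv
  have key : 0 ≤ (((x + 1) * σ + x) - ((y + 1) * τ + y)) * (x - y) := by
    unfold sgnSet at hσ hτ
    rcases lt_trichotomy x 0 with hx | hx | hx <;> rcases lt_trichotomy y 0 with hy | hy | hy
    all_goals
      first
        | subst hx
        | skip
      first
        | subst hy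
        | skip
      simp_all [not_lt_of_gt]
    all_goals try nlinarith [hσ.1, hσ.2]
    all_goals try nlinarith [hτ.1, hτ.2]
    all_goals try nlinarith [sq_nonneg (x - y)]
  nlinarith [mul_nonneg (sub_nonneg.2 hk) (sq_nonneg (x - y))]
end
end

section
/- Let k₁, k₂ ∈ ℝ and define the set-valued map F : ℝ ⇉ ℝ (the linearized Stribeck friction model) by F(x) = {-k₁x + 1} for x > 0, F(x) = {-k₂x - 1} for x < 0, and F(0) = [-1, 1]. Then for every k ≥ max(|k₁|, |k₂|), F is hypomonotone with constant k; that is, (u - v)·(x - y) ≥ -k·(x - y)² for all x, y ∈ ℝ, u ∈ F(x), v ∈ F(y). -/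
open Set

noncomputable section

/-- The linearized Stribeck friction model (with multivalued part at zero velocity):
`F(x) = {-k₁x + 1}` for `x > 0`, `{-k₂x - 1}` for `x < 0`, and `[-1,1]` at `x = 0`. -/
def stribeck (k₁ k₂ : ℝ) (x : ℝ) : Set ℝ :=
  if 0 < x then {-k₁ * x + 1} else if x < 0 then {-k₂ * x - 1} else Icc (-1) 1

theorem stribeck_aux (k₁ k₂ k : ℝ) (h1 : k₁ ≤ k) (h2 : k₂ ≤ k) (x y u v : ℝ) (hxy : x < y)
    (hu : u ∈ stribeck k₁ k₂ x) (hv : v ∈ stribeck k₁ k₂ y) :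
    u + k * x ≤ v + k * y := by
  unfold stribeck at hu hv
  split_ifs at hu hv with a b c d e f <;>
    simp only [Set.mem_singleton_iff, Set.mem_Icc] at hu hv <;>
    first
    | linarith
    | (subst hu; subst hv; nlinarith)
    | (have hx : x = 0 := by linarith
       subst hx; nlinarith)
    | (have hy : y = 0 := by linarith
       subst hy; nlinarith)

/-- The linearized Stribeck friction model is hypomonotone with constant `k` for every
`k ≥ max(|k₁|, |k₂|)`. -/
theorem stribeck_hypomonotone (k₁ k₂ k : ℝ) (hk : max |k₁| |k₂| ≤ k) (x y u v : ℝ)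
    (hu : u ∈ stribeck k₁ k₂ x) (hv : v ∈ stribeck k₁ k₂ y) :
    -(k * (x - y) ^ 2) ≤ (u - v) * (x - y) := by
  have h1 : k₁ ≤ k := (le_abs_self _).trans ((le_max_left _ _).trans hk)
  have h2 : k₂ ≤ k := (le_abs_self _).trans ((le_max_right _ _).trans hk)
  rcases lt_trichotomy x y with h | h | h
  · have := stribeck_aux k₁ k₂ k h1 h2 x y u v h hu hv
    nlinarith [mul_nonneg (sub_nonneg.2 this) (sub_nonneg.2 h.le)]
  · subst h; simp
  · have := stribeck_aux k₁ k₂ k h1 h2 y x v u h hv hu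
    nlinarith [mul_nonneg (sub_nonneg.2 this) (sub_nonneg.2 h.le)]
end
end

section
/- The set-valued map F : ℝ ⇉ ℝ defined by F(x) = {σ/(1 + x²) : σ ∈ sgn(arctan x)} is hypomonotone with constant k for every k ≥ 9/(8√3); that is, for all x, y ∈ ℝ, u ∈ F(x) and v ∈ F(y), one has (u - v)·(x - y) ≥ -k·(x - y)². -/
open Set

noncomputable section

theorem aux_k (k : ℝ) (hk : 9 / (8 * Real.sqrt 3) ≤ k) (x y : ℝ) :
    x + y ≤ k * ((1 + x ^ 2) * (1 + y ^ 2)) := by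
  have hr : 0 < Real.sqrt 3 := by positivity
  have hr2 : Real.sqrt 3 ^ 2 = 3 := Real.sq_sqrt (by norm_num)
  set r := Real.sqrt 3
  have e : 9 / (8 * r) = 3 * r / 8 := by
    field_simp
    linarith
  rw [e] at hk
  have h1 : 8 / 9 + 2 * (x + y) ^ 2 / 3 ≤ (1 + x ^ 2) * (1 + y ^ 2) := by
    nlinarith [sq_nonneg (x * y - 1 / 3), sq_nonneg (x - y)]
  have h2 : 3 * r / 8 * (8 / 9 + 2 * (x + y) ^ 2 / 3) - (x + y)
      = r / 12 * (r * (x + y) - 2) ^ 2 := by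
    linear_combination (-(r * (x + y) ^ 2 / 12) + (x + y) / 3) * hr2
  have h3 : 0 ≤ r / 12 * (r * (x + y) - 2) ^ 2 := by positivity
  have h4 : 3 * r / 8 * (8 / 9 + 2 * (x + y) ^ 2 / 3) ≤
      3 * r / 8 * ((1 + x ^ 2) * (1 + y ^ 2)) := by gcongr
  have h5 : 3 * r / 8 * ((1 + x ^ 2) * (1 + y ^ 2)) ≤ k * ((1 + x ^ 2) * (1 + y ^ 2)) := by
    gcongr
  linarith

theorem aux_f (k : ℝ) (hk : 9 / (8 * Real.sqrt 3) ≤ k) (x y : ℝ) (hxy : x ≤ y) :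
    1 / (1 + x ^ 2) - 1 / (1 + y ^ 2) ≤ k * (y - x) := by
  have h := aux_k k hk x y
  have e : 1 / (1 + x ^ 2) - 1 / (1 + y ^ 2)
      = (x + y) * (y - x) / ((1 + x ^ 2) * (1 + y ^ 2)) := by
    field_simp
    ring
  rw [e, div_le_iff₀ (by positivity)]
  nlinarith [mul_le_mul_of_nonneg_right h (sub_nonneg.2 hxy)]

theorem aux_mem (x u : ℝ) (hu : ∃ σ ∈ sgnSet (Real.arctan x), u = σ / (1 + x ^ 2)) :
    u ≤ 1 / (1 + x ^ 2) ∧ -(1 / (1 + x ^ 2)) ≤ u ∧ (0 < x → u = 1 / (1 + x ^ 2)) ∧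
      (x < 0 → u = -(1 / (1 + x ^ 2))) := by
  obtain ⟨σ, hσ, rfl⟩ := hu
  have hs : -1 ≤ σ ∧ σ ≤ 1 ∧ (0 < x → σ = 1) ∧ (x < 0 → σ = -1) := by
    unfold sgnSet at hσ
    simp only [Real.arctan_pos, Real.arctan_lt_zero] at hσ
    split_ifs at hσ with h1 h2
    · simp only [mem_singleton_iff] at hσ
      subst hσ
      exact ⟨by norm_num, le_rfl, fun _ => rfl, fun h => absurd h1 h.not_gt⟩
    · simp only [mem_singleton_iff] at hσ
      subst hσ
      exact ⟨le_rfl, by norm_num, fun h => absurd h h1, fun _ => rfl⟩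
    · exact ⟨hσ.1, hσ.2, fun h => absurd h h1, fun h => absurd h h2⟩
  obtain ⟨a, b, c, d⟩ := hs
  refine ⟨by gcongr, ?_, fun h => by rw [c h], fun h => by rw [d h, neg_div]⟩
  rw [← neg_div]
  gcongr

theorem aux_lt (k : ℝ) (hk : 9 / (8 * Real.sqrt 3) ≤ k) (x y u v : ℝ) (hxy : x < y)
    (hu : ∃ σ ∈ sgnSet (Real.arctan x), u = σ / (1 + x ^ 2))
    (hv : ∃ τ ∈ sgnSet (Real.arctan y), v = τ / (1 + y ^ 2)) :
    u - v ≤ k * (y - x) := by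
  obtain ⟨a, b, c, d⟩ := aux_mem x u hu
  obtain ⟨a', b', c', d'⟩ := aux_mem y v hv
  have hk0 : 0 ≤ k := le_trans (by positivity) hk
  rcases le_or_gt 0 x with h | h
  · have := aux_f k hk x y hxy.le
    have := c' (by linarith)
    linarith
  · have hd := d h
    rcases le_or_gt y 0 with h' | h'
    · have := aux_f k hk (-y) (-x) (by linarith)
      simp only [even_two, Even.neg_pow] at this
      linarith
    · have := c' h'
      have : 0 < 1 / (1 + x ^ 2) := by positivity
      have : 0 < 1 / (1 + y ^ 2) := by positivity
      have : 0 ≤ k * (y - x) := mul_nonneg hk0 (by linarith)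
      linarith

/-- The set-valued map `x ↦ sgn(arctan x)/(1+x²)` is hypomonotone with constant `k`
for every `k ≥ 9/(8√3)`. -/
theorem arctan_sgn_hypomonotone (k : ℝ) (hk : 9 / (8 * Real.sqrt 3) ≤ k) (x y u v : ℝ)
    (hu : ∃ σ ∈ sgnSet (Real.arctan x), u = σ / (1 + x ^ 2))
    (hv : ∃ τ ∈ sgnSet (Real.arctan y), v = τ / (1 + y ^ 2)) :
    -(k * (x - y) ^ 2) ≤ (u - v) * (x - y) := by
  rcases lt_trichotomy x y with h | h | h
  · nlinarith [mul_le_mul_of_nonneg_right (aux_lt k hk x y u v h hu hv) (sub_pos.2 h).le]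
  · subst h
    simp
  · nlinarith [mul_le_mul_of_nonneg_right (aux_lt k hk y x v u h hv hu) (sub_pos.2 h).le]
end
end

section
/- For all x, s ∈ ℝ: s ∈ sgn(x) if and only if there exist λ₁, λ₂ ∈ ℝ satisfying the mixed complementarity conditions s = 1 - 2λ₁, λ₁ ≥ 0, x + λ₂ ≥ 0, λ₁·(x + λ₂) = 0, λ₂ ≥ 0, 1 - λ₁ ≥ 0, and λ₂·(1 - λ₁) = 0. -/
open Set

noncomputable section

/-- Mixed complementarity representation of the sign multifunction:
`s ∈ sgn(x)` iff there exist multipliers `λ₁, λ₂` with `s = 1 - 2λ₁`,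
`0 ≤ λ₁ ⊥ x + λ₂ ≥ 0` and `0 ≤ λ₂ ⊥ 1 - λ₁ ≥ 0`. -/
theorem mem_sgnSet_iff_complementarity (x s : ℝ) :
    s ∈ sgnSet x ↔ ∃ l₁ l₂ : ℝ, s = 1 - 2 * l₁ ∧
      0 ≤ l₁ ∧ 0 ≤ x + l₂ ∧ l₁ * (x + l₂) = 0 ∧
      0 ≤ l₂ ∧ 0 ≤ 1 - l₁ ∧ l₂ * (1 - l₁) = 0 := by
  unfold sgnSet
  rcases lt_trichotomy x 0 with h | h | h
  · rw [if_neg (not_lt.mpr h.le), if_pos h, mem_singleton_iff]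
    constructor
    · rintro rfl
      exact ⟨1, -x, by norm_num, by norm_num, by simp, by simp, by linarith, by norm_num, by simp⟩
    · rintro ⟨a, b, rfl, h1, h2, h3, h4, h5, h6⟩
      rcases mul_eq_zero.mp h6 with h7 | h7 <;> linarith
  · subst h
    simp only [lt_irrefl, if_false, mem_Icc]
    constructor
    · rintro ⟨h1, h2⟩
      exact ⟨(1 - s) / 2, 0, by ring, by linarith, by simp, by simp, le_refl _, by linarith, by simp⟩
    · rintro ⟨a, b, rfl, h1, h2, h3, h4, h5, h6⟩
      constructor <;> linarith
  · rw [if_pos h, mem_singleton_iff]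
    constructor
    · rintro rfl
      exact ⟨0, 0, by norm_num, le_refl _, by linarith, by simp, le_refl _, by norm_num, by simp⟩
    · rintro ⟨a, b, rfl, h1, h2, h3, h4, h5, h6⟩
      rcases mul_eq_zero.mp h3 with h7 | h7 <;> linarith
end
end

section
/- For every h > 0, every ρ ≥ 1 and every b ∈ ℝ, there exists a unique pair (x, s) ∈ ℝ × ℝ with s ∈ sgn(x) and x - b + h·(x + 1)·s + h·ρ·x = 0; equivalently, the generalized equation 0 ∈ (1 + hρ)·x + h·(x + 1)·sgn(x) - b, arising from one implicit Euler step of ẋ ∈ -(x+1)sgn(x) with hypomonotonicity regularization parameter ρ, has a unique solution. -/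
open Set

noncomputable section

/-- The generalized equation `0 ∈ (1 + hρ)x + h(x+1)·sgn(x) - b`, arising from one implicit
Euler step of `ẋ ∈ -(x+1)sgn(x)` with hypomonotonicity regularization `ρ ≥ 1`, has a unique
solution for every `h > 0` and `b ∈ ℝ`. -/
theorem implicitEuler_hypomonotone_step_existsUnique (h ρ b : ℝ) (hh : 0 < h) (hρ : 1 ≤ ρ) :
    ∃! p : ℝ × ℝ, p.2 ∈ sgnSet p.1 ∧ p.1 - b + h * (p.1 + 1) * p.2 + h * ρ * p.1 = 0 := by
  have key : ∀ x s : ℝ, s ∈ sgnSet x ↔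
      (0 < x ∧ s = 1) ∨ (x < 0 ∧ s = -1) ∨ (x = 0 ∧ -1 ≤ s ∧ s ≤ 1) := by
    intro x s
    unfold sgnSet
    rcases lt_trichotomy x 0 with hx | hx | hx
    · simp [hx, hx.ne, not_lt.2 hx.le]
    · simp [hx]
    · simp [hx, hx.ne', not_lt.2 hx.le]
  have hA : 0 < 1 + h * ρ + h := by nlinarith
  have hB : 0 < 1 + h * ρ - h := by nlinarith
  -- sign of the solution determines the position of `b`
  have pos : ∀ x : ℝ, 0 < x → x - b + h * (x + 1) * 1 + h * ρ * x = 0 → h < b := by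
    intro x hx e
    nlinarith [mul_pos hA hx]
  have neg : ∀ x : ℝ, x < 0 → x - b + h * (x + 1) * (-1) + h * ρ * x = 0 → b < -h := by
    intro x hx e
    nlinarith [mul_pos hB (neg_pos.2 hx)]
  have zero : ∀ s : ℝ, (0 : ℝ) - b + h * (0 + 1) * s + h * ρ * 0 = 0 → b = h * s := by
    intro s e
    linarith
  have ex : ∃ p : ℝ × ℝ, p.2 ∈ sgnSet p.1 ∧
      p.1 - b + h * (p.1 + 1) * p.2 + h * ρ * p.1 = 0 := by
    rcases lt_or_ge h b with h1 | h1
    · refine ⟨((b - h) / (1 + h * ρ + h), 1), (key _ _).2 (Or.inl ⟨div_pos (by linarith) hA, rfl⟩), ?_⟩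
      have := div_mul_cancel₀ (b - h) hA.ne'
      simp only
      linear_combination this
    rcases lt_or_ge b (-h) with h2 | h2
    · refine ⟨((b + h) / (1 + h * ρ - h), -1),
        (key _ _).2 (Or.inr (Or.inl ⟨div_neg_of_neg_of_pos (by linarith) hB, rfl⟩)), ?_⟩
      have := div_mul_cancel₀ (b + h) hB.ne'
      simp only
      linear_combination this
    · refine ⟨(0, b / h), (key _ _).2 (Or.inr (Or.inr ⟨rfl, ?_, ?_⟩)), ?_⟩
      · simp only
        rw [le_div_iff₀ hh]; linarith
      · simp only
        rw [div_le_iff₀ hh]; linarith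
      · have := div_mul_cancel₀ b hh.ne'
        simp only
        linear_combination this
  obtain ⟨p, hp⟩ := ex
  refine ⟨p, hp, ?_⟩
  obtain ⟨x, s⟩ := p
  rintro ⟨y, t⟩ ⟨hy, ey⟩
  obtain ⟨hx, e⟩ := hp
  simp only [key] at hx hy
  simp only at e ey
  rw [Prod.mk.injEq]
  rcases hx with ⟨hx, rfl⟩ | ⟨hx, rfl⟩ | ⟨rfl, hs1, hs2⟩ <;>
    rcases hy with ⟨hy, rfl⟩ | ⟨hy, rfl⟩ | ⟨rfl, ht1, ht2⟩
  · exact ⟨mul_left_cancel₀ hA.ne' (by linear_combination ey - e), rfl⟩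
  · linarith [pos _ hx e, neg _ hy ey]
  · nlinarith [pos _ hx e, zero _ ey]
  · linarith [neg _ hx e, pos _ hy ey]
  · exact ⟨mul_left_cancel₀ hB.ne' (by linear_combination ey - e), rfl⟩
  · nlinarith [neg _ hx e, zero _ ey]
  · nlinarith [pos _ hy ey, zero _ e]
  · nlinarith [neg _ hy ey, zero _ e]
  · exact ⟨rfl, mul_left_cancel₀ hh.ne' (by linear_combination ey - e)⟩
end
end
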